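/- arXiv:1906.11274 — 2 statements merged into one kernel-verified Lean document; each statement's English description precedes it below -/
import Mathlib

section
/- Let 1 < p < 5 and f : ℝ → ℝ with |f(s)| ≤ C₀·s^((p-1)/2) for s ≥ 0 and F(s) = ∫₀ˢ f(v) dv. Fix λ = 100, φ(x) = 100·tanh(x/100), and I(u(t)) = Im ∫_ℝ φ(x) u(t,x)·conj(∂ₓu(t,x)) dx. There exist ε > 0 and C > 0 such that: if u is a smooth solution of i∂ₜu + ∂ₓₓu = f(|u|²)u, odd in x, with u(t,·) in the Schwartz class in x for each t and sup_{t∈ℝ}(‖u(t,·)‖_{L²(ℝ)}² + ‖∂ₓu(t,·)‖_{L²(ℝ)}²) ≤ ε², then for all t, -d/dt I(u(t)) ≥ C · ∫_ℝ sech(x)(|∂ₓu(t,x)|² + |u(t,x)|²) dx. -/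
namespace VC

open MeasureTheory Real

/-- the basic profile `tanh (x/100)` -/
noncomputable def y (x : ℝ) : ℝ := Real.tanh (x / 100)

/-- the weight `sech² (x/100)` -/
noncomputable def W (x : ℝ) : ℝ := 1 - y x ^ 2

lemma W_eq (x : ℝ) : W x = 1 / Real.cosh (x / 100) ^ 2 := by
  have h := Real.cosh_sq' (x / 100)
  have hc := Real.cosh_pos (x / 100)
  unfold W y
  rw [Real.tanh_eq_sinh_div_cosh]
  field_simp
  linarith

lemma W_pos (x : ℝ) : 0 < W x := by
  rw [W_eq]
  have hc := Real.cosh_pos (x / 100)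
  positivity

lemma W_le (x : ℝ) : W x ≤ 1 := by
  unfold W; nlinarith [sq_nonneg (y x)]

lemma y_sq_lt (x : ℝ) : y x ^ 2 < 1 := by
  have := W_pos x
  unfold W at this; linarith

lemma y_abs (x : ℝ) : |y x| ≤ 1 := by
  rw [← sq_le_one_iff_abs_le_one]; exact (y_sq_lt x).le

lemma y_deriv (x : ℝ) : HasDerivAt y (W x / 100) x := by
  have hc := (Real.cosh_pos (x / 100)).ne'
  have h0 : HasDerivAt (fun x : ℝ => x / 100) (1 / 100) x := (hasDerivAt_id x).div_const 100
  have h1 := (h0.sinh).div (h0.cosh) hc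
  have h2 : y = fun x => Real.sinh (x / 100) / Real.cosh (x / 100) := by
    funext z; unfold y; rw [Real.tanh_eq_sinh_div_cosh]
  rw [h2]
  refine HasDerivAt.congr_deriv h1 ?_
  rw [W_eq]
  have h := Real.cosh_sq' (x / 100)
  field_simp
  linarith

lemma y_cont : Continuous y := continuous_iff_continuousAt.2 fun x => (y_deriv x).continuousAt

lemma W_cont : Continuous W := by
  unfold W; exact continuous_const.sub (y_cont.pow 2)

lemma W_deriv (x : ℝ) : HasDerivAt W (-(2 * y x * W x / 100)) x := by
  have := ((y_deriv x).pow 2).const_sub 1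
  refine HasDerivAt.congr_deriv this ?_
  simp; ring

lemma y_neg (x : ℝ) : y (-x) = - y x := by
  unfold y; rw [neg_div, Real.tanh_neg]

lemma W_neg (x : ℝ) : W (-x) = W x := by
  unfold W; rw [y_neg]; ring

lemma y_nonneg {x : ℝ} (hx : 0 ≤ x) : 0 ≤ y x := by
  unfold y
  rw [Real.tanh_eq_sinh_div_cosh]
  have := Real.cosh_pos (x / 100)
  have := Real.sinh_nonneg_iff.2 (show 0 ≤ x / 100 by positivity)
  positivity

lemma y_zero : y 0 = 0 := by simp [y]

lemma x_sq_W (x : ℝ) : x ^ 2 * W x ≤ 10000 := by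
  have hc := Real.cosh_pos (x / 100)
  have h := Real.cosh_sq' (x / 100)
  have h2 : (x / 100) ^ 2 ≤ Real.sinh (x / 100) ^ 2 := by
    rw [← sq_abs (Real.sinh _), Real.abs_sinh, ← sq_abs (x / 100)]
    exact pow_le_pow_left₀ (abs_nonneg _) (Real.self_le_sinh_iff.2 (abs_nonneg _)) 2
  rw [W_eq, mul_one_div, div_le_iff₀ (by positivity)]
  nlinarith

lemma sech_le (x : ℝ) : 1 / Real.cosh x ≤ W x ^ 2 := by
  have hc := Real.cosh_pos (x / 100)
  have hd : ∀ s : ℝ, Real.cosh s ^ 2 ≤ Real.cosh (2 * s) := by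
    intro s
    rw [Real.cosh_two_mul]
    nlinarith [sq_nonneg (Real.sinh s)]
  have h1 := hd (x / 100)
  have h2 := hd (2 * (x / 100))
  have h3 : Real.cosh (2 * (2 * (x / 100))) ≤ Real.cosh x := by
    rw [Real.cosh_le_cosh]
    rw [show 2 * (2 * (x / 100)) = (1 / 25) * x by ring, abs_mul]
    have := abs_nonneg x
    rw [abs_of_pos (by norm_num : (0 : ℝ) < 1 / 25)]
    linarith
  rw [W_eq, div_pow, one_pow]
  apply one_div_le_one_div_of_le (by positivity)
  have h4 : (Real.cosh (x / 100) ^ 2) ^ 2 ≤ Real.cosh (2 * (x / 100)) ^ 2 :=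
    pow_le_pow_left₀ (by positivity) h1 2
  linarith

/-- auxiliary multiplier on the half line -/
noncomputable def bb (x : ℝ) : ℝ := (1 - y x) * (6 / 5 - y x + 3 / 5 * y x ^ 2)

lemma bb_cont : Continuous bb := by
  unfold bb; have := y_cont; fun_prop

lemma bb_deriv (x : ℝ) : HasDerivAt bb
    ((-(6 / 5 - y x + 3 / 5 * y x ^ 2) + (1 - y x) * (- 1 + 6 / 5 * y x)) * (W x / 100)) x := by
  have h := y_deriv x
  have h1 := (h.const_sub 1).mul ((h.const_sub (6 / 5)).add ((h.pow 2).const_mul (3 / 5)))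
  refine HasDerivAt.congr_deriv h1 ?_
  simp; ring

lemma bb_ineq {x : ℝ} (hx : 0 ≤ x) :
    (-(6 / 5 - y x + 3 / 5 * y x ^ 2) + (1 - y x) * (- 1 + 6 / 5 * y x)) * W x + bb x ^ 2
      ≤ - (7 / 10) * W x := by
  have h0 := y_nonneg hx
  have h1 : y x ≤ 1 := (abs_le.1 (y_abs x)).2
  unfold bb W
  set z := y x
  have key : 0 ≤ (1 + z) * ((6 / 5 - z + 3 / 5 * z ^ 2) - (1 - z) * (- 1 + 6 / 5 * z))
      - (1 - z) * (6 / 5 - z + 3 / 5 * z ^ 2) ^ 2 - 7 / 10 * (1 + z) := by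
    have e1 : 0 ≤ z * (1 - z) := mul_nonneg h0 (by linarith)
    nlinarith [mul_nonneg h0 e1, mul_nonneg e1 e1, mul_nonneg h0 (sq_nonneg (z - 1/2)),
      mul_nonneg (mul_nonneg h0 h0) e1, mul_nonneg (mul_nonneg h0 e1) e1,
      mul_nonneg (mul_nonneg h0 h0) (mul_nonneg h0 e1), sq_nonneg z, sq_nonneg (z - 1/2)]
  nlinarith [mul_nonneg (show 0 ≤ 1 - z by linarith) key]

lemma bb_abs {x : ℝ} : |bb x| ≤ 10 := by
  have h := abs_le.1 (y_abs x)
  unfold bb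
  rw [abs_mul]
  have h1 : |1 - y x| ≤ 2 := abs_le.2 ⟨by linarith, by linarith⟩
  have h2 : |6 / 5 - y x + 3 / 5 * y x ^ 2| ≤ 5 := by
    have := y_sq_lt x
    have := sq_nonneg (y x)
    exact abs_le.2 ⟨by linarith, by linarith⟩
  calc _ ≤ (2 : ℝ) * 5 := mul_le_mul h1 h2 (abs_nonneg _) (by norm_num)
    _ = 10 := by norm_num

end VC

namespace VC

open MeasureTheory Real

/-- a (real and imaginary part of a) spatial profile -/
structure Prof (a b a1 b1 : ℝ → ℝ) : Prop where
  ha : ∀ x, HasDerivAt a (a1 x) x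
  hb : ∀ x, HasDerivAt b (b1 x) x
  ca1 : Continuous a1
  cb1 : Continuous b1
  hS : Integrable (fun x => a x ^ 2 + b x ^ 2 + (a1 x ^ 2 + b1 x ^ 2))
  oa : ∀ x, a (-x) = - a x
  ob : ∀ x, b (-x) = - b x

namespace Prof

variable {a b a1 b1 : ℝ → ℝ}

lemma ca (P : Prof a b a1 b1) : Continuous a := continuous_iff_continuousAt.2 fun x => (P.ha x).continuousAt
lemma cb (P : Prof a b a1 b1) : Continuous b := continuous_iff_continuousAt.2 fun x => (P.hb x).continuousAt

lemma integ (P : Prof a b a1 b1) {g : ℝ → ℝ} (hg : Continuous g) (C : ℝ)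
    (h : ∀ x, |g x| ≤ C * (a x ^ 2 + b x ^ 2 + (a1 x ^ 2 + b1 x ^ 2))) : Integrable g :=
  (P.hS.const_mul C).mono' hg.aestronglyMeasurable (Filter.Eventually.of_forall h)

lemma a1_even (P : Prof a b a1 b1) (x : ℝ) : a1 (-x) = a1 x := by
  have h := (P.ha (-x)).comp x (hasDerivAt_neg x)
  have h2 : (a ∘ fun x => -x) = fun x => - a x := by funext z; simp [P.oa]
  have h3 := (P.ha x).neg
  have h4 : a1 (-x) * -1 = - a1 x := by
    refine HasDerivAt.unique h ?_
    rw [show (a ∘ Neg.neg) = - a from by funext z; simp [P.oa]]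
    exact h3
  linarith

lemma b1_even (P : Prof a b a1 b1) (x : ℝ) : b1 (-x) = b1 x := by
  have h := (P.hb (-x)).comp x (hasDerivAt_neg x)
  have h3 := (P.hb x).neg
  have h4 : b1 (-x) * -1 = - b1 x := by
    refine HasDerivAt.unique h ?_
    rw [show (b ∘ Neg.neg) = - b from by funext z; simp [P.ob]]
    exact h3
  linarith

lemma a_zero (P : Prof a b a1 b1) : a 0 = 0 := by have := P.oa 0; simp at this; linarith
lemma b_zero (P : Prof a b a1 b1) : b 0 = 0 := by have := P.ob 0; simp at this; linarith

lemma w_deriv (P : Prof a b a1 b1) (x : ℝ) : HasDerivAt (fun x => a x ^ 2 + b x ^ 2)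
    (2 * (a x * a1 x + b x * b1 x)) x := by
  refine HasDerivAt.congr_deriv (((P.ha x).pow 2).add ((P.hb x).pow 2)) ?_
  simp; ring

lemma w_sup (P : Prof a b a1 b1) (x : ℝ) : a x ^ 2 + b x ^ 2 ≤
    ∫ x, (a x ^ 2 + b x ^ 2 + (a1 x ^ 2 + b1 x ^ 2)) := by
  have ca := P.ca
  have cb := P.cb
  have ca1 := P.ca1
  have cb1 := P.cb1
  have i1 : Integrable (fun x => 2 * (a x * a1 x + b x * b1 x)) := by
    refine P.integ (by fun_prop) 1 fun x => ?_
    rw [abs_le]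
    constructor <;>
    nlinarith [sq_nonneg (a x + a1 x), sq_nonneg (a x - a1 x),
      sq_nonneg (b x + b1 x), sq_nonneg (b x - b1 x)]
  have i2 : Integrable (fun x => a x ^ 2 + b x ^ 2) := by
    refine P.integ (by fun_prop) 1 fun x => ?_
    rw [abs_of_nonneg (by positivity)]
    nlinarith [sq_nonneg (a1 x), sq_nonneg (b1 x)]
  have ht := tendsto_zero_of_hasDerivAt_of_integrableOn_Iic (a := x) (fun z _ => P.w_deriv z)
    i1.integrableOn i2.integrableOn
  have h := integral_Iic_of_hasDerivAt_of_tendsto' (a := x) (fun z _ => P.w_deriv z)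
    i1.integrableOn ht
  simp only [sub_zero] at h
  rw [← h]
  calc _ ≤ ∫ x in Set.Iic x, (a x ^ 2 + b x ^ 2 + (a1 x ^ 2 + b1 x ^ 2)) := by
        refine integral_mono i1.integrableOn P.hS.integrableOn fun z => ?_
        simp only
        nlinarith [sq_nonneg (a z - a1 z), sq_nonneg (b z - b1 z)]
    _ ≤ _ := setIntegral_le_integral P.hS (Filter.Eventually.of_forall fun z => by
        simp only [Pi.zero_apply]; positivity)

lemma Kd_bound (x p q : ℝ) : W x * (q - y x / 100 * p) ^ 2 ≤ 2 * (p ^ 2 + q ^ 2) := by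
  have h1 := W_pos x
  have h2 := W_le x
  have h3 := y_sq_lt x
  have h4 : (q - y x / 100 * p) ^ 2 ≤ 2 * (p ^ 2 + q ^ 2) := by
    nlinarith [sq_nonneg (q + y x / 100 * p), mul_nonneg (sq_nonneg p) (show 0 ≤ 1 - y x ^ 2 by linarith), sq_nonneg p, sq_nonneg q]
  nlinarith [sq_nonneg (q - y x / 100 * p)]

lemma Kd_int (P : Prof a b a1 b1) : Integrable (fun x => W x * ((a1 x - y x / 100 * a x) ^ 2
    + (b1 x - y x / 100 * b x) ^ 2)) := by
  have ca := P.ca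
  have cb := P.cb
  have ca1 := P.ca1
  have cb1 := P.cb1
  have := W_cont
  have := y_cont
  refine P.integ (by fun_prop) 2 fun x => ?_
  have h1 := W_pos x
  rw [abs_of_nonneg (by positivity)]
  have := Kd_bound x (a x) (a1 x)
  have := Kd_bound x (b x) (b1 x)
  linarith

lemma Md_int (P : Prof a b a1 b1) : Integrable (fun x => W x ^ 2 * (a x ^ 2 + b x ^ 2) / 10000) := by
  have ca := P.ca
  have cb := P.cb
  have := W_cont
  refine P.integ (by fun_prop) 1 fun x => ?_
  have h1 := W_pos x
  have h2 := W_le x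
  rw [abs_of_nonneg (by positivity)]
  have h3 : W x ^ 2 ≤ 1 := pow_le_one₀ h1.le h2
  nlinarith [sq_nonneg (a x), sq_nonneg (b x), sq_nonneg (a1 x), sq_nonneg (b1 x), mul_le_mul_of_nonneg_right h3 (show 0 ≤ a x ^ 2 + b x ^ 2 by positivity)]

lemma hardy (P : Prof a b a1 b1) : 7 / 10 * (∫ x, W x ^ 2 * (a x ^ 2 + b x ^ 2) / 10000) ≤
    ∫ x, W x * ((a1 x - y x / 100 * a x) ^ 2 + (b1 x - y x / 100 * b x) ^ 2) := by
  have ca := P.ca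
  have cb := P.cb
  have ca1 := P.ca1
  have cb1 := P.cb1
  have cW := W_cont
  have cy := y_cont
  have cbb := bb_cont
  set g : ℝ → ℝ := fun x => W x * ((a1 x - y x / 100 * a x) ^ 2
    + (b1 x - y x / 100 * b x) ^ 2) - 7 / 10 * (W x ^ 2 * (a x ^ 2 + b x ^ 2) / 10000) with hg
  have ig : Integrable g := P.Kd_int.sub (P.Md_int.const_mul _)
  suffices h : 0 ≤ ∫ x, g x by
    rw [hg, integral_sub P.Kd_int (P.Md_int.const_mul _), integral_const_mul] at h
    linarith
  have heven : ∀ x, g |x| = g x := by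
    intro x
    rcases abs_choice x with h | h <;> rw [h]
    simp only [hg, W_neg, y_neg, P.oa, P.ob, P.a1_even, P.b1_even]
    ring
  have e1 : ∫ x, g x = 2 * ∫ x in Set.Ioi (0 : ℝ), g x := by
    rw [← integral_comp_abs]
    exact integral_congr_ae (Filter.Eventually.of_forall fun x => (heven x).symm)
  -- the boundary function
  have hd : ∀ x, HasDerivAt (fun x => bb x / 100 * (W x * (a x ^ 2 + b x ^ 2)))
      (((-(6 / 5 - y x + 3 / 5 * y x ^ 2) + (1 - y x) * (- 1 + 6 / 5 * y x)) * (W x / 100)) / 100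
        * (W x * (a x ^ 2 + b x ^ 2)) + bb x / 100 * (-(2 * y x * W x / 100) * (a x ^ 2 + b x ^ 2)
        + W x * (2 * (a x * a1 x + b x * b1 x)))) x := fun x =>
    ((bb_deriv x).div_const 100).mul ((W_deriv x).mul (P.w_deriv x))
  have iB : Integrable (fun x => bb x / 100 * (W x * (a x ^ 2 + b x ^ 2))) := by
    refine P.integ (by fun_prop) 1 fun x => ?_
    have h1 := W_pos x
    have h2 := W_le x
    have h3 := bb_abs (x := x)
    rw [abs_mul, abs_of_nonneg (show 0 ≤ W x * (a x ^ 2 + b x ^ 2) by positivity), abs_div,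
      abs_of_pos (show (0 : ℝ) < 100 by norm_num)]
    have h4 : W x * (a x ^ 2 + b x ^ 2) ≤ 1 * (a x ^ 2 + b x ^ 2) :=
      mul_le_mul_of_nonneg_right h2 (by positivity)
    have h5 : |bb x| / 100 ≤ 1 := by linarith
    calc _ ≤ 1 * (1 * (a x ^ 2 + b x ^ 2)) :=
          mul_le_mul h5 h4 (by positivity) (by norm_num)
      _ ≤ _ := by nlinarith [sq_nonneg (a1 x), sq_nonneg (b1 x)]
  have iB' : Integrable (fun x => ((-(6 / 5 - y x + 3 / 5 * y x ^ 2) + (1 - y x) * (- 1 + 6 / 5 * y x)) * (W x / 100)) / 100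
        * (W x * (a x ^ 2 + b x ^ 2)) + bb x / 100 * (-(2 * y x * W x / 100) * (a x ^ 2 + b x ^ 2)
        + W x * (2 * (a x * a1 x + b x * b1 x)))) := by
    refine P.integ (by fun_prop) 100 fun x => ?_
    have h1 := W_pos x
    have h2 := W_le x
    have h3 := bb_abs (x := x)
    have h6 := y_abs x
    have h7 := abs_le.1 h6
    have h8 := y_sq_lt x
    set w := a x ^ 2 + b x ^ 2 with hw
    set q := 2 * (a x * a1 x + b x * b1 x) with hq
    have w0 : 0 ≤ w := by positivity
    have s0 : 0 ≤ a1 x ^ 2 + b1 x ^ 2 := by positivity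
    have hqb : |q| ≤ w + (a1 x ^ 2 + b1 x ^ 2) := by
      rw [abs_le]; constructor <;>
      nlinarith [sq_nonneg (a x + a1 x), sq_nonneg (a x - a1 x),
        sq_nonneg (b x + b1 x), sq_nonneg (b x - b1 x)]
    have aW : |W x| ≤ 1 := by rw [abs_of_pos h1]; exact h2
    have t1 : |-(6 / 5 - y x + 3 / 5 * y x ^ 2) + (1 - y x) * (- 1 + 6 / 5 * y x)| ≤ 10 := by
      rw [abs_le]; constructor <;> nlinarith [sq_nonneg (y x)]
    have t2 : |((-(6 / 5 - y x + 3 / 5 * y x ^ 2) + (1 - y x) * (- 1 + 6 / 5 * y x)) * (W x / 100)) / 100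
        * (W x * w)| ≤ 10 * w := by
      rw [abs_mul, abs_div, abs_mul, abs_div, abs_mul, abs_of_nonneg w0,
        show |(100 : ℝ)| = 100 by norm_num]
      calc _ ≤ 10 * (1 / 100) / 100 * (1 * w) := by gcongr
        _ ≤ _ := by linarith
    have t3 : |bb x / 100 * (-(2 * y x * W x / 100) * w + W x * q)| ≤
        10 / 100 * ((2 * 1 * 1 / 100) * w + 1 * (w + (a1 x ^ 2 + b1 x ^ 2))) := by
      rw [abs_mul, abs_div]
      have : |-(2 * y x * W x / 100) * w + W x * q| ≤ (2 * |y x| * |W x| / 100) * w + |W x| * |q| := by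
        refine (abs_add_le _ _).trans ?_
        rw [abs_mul, abs_neg, abs_div, abs_mul, abs_mul, abs_mul, abs_of_nonneg w0]
        norm_num
      have h100 : |(100 : ℝ)| = 100 := by norm_num
      rw [h100]
      refine mul_le_mul (by gcongr) (this.trans ?_) (abs_nonneg _) (by norm_num)
      gcongr
    refine (abs_add_le _ _).trans ?_
    linarith
  have ht := tendsto_zero_of_hasDerivAt_of_integrableOn_Ioi (a := 0) (fun z _ => hd z)
    iB'.integrableOn iB.integrableOn
  have h := integral_Ioi_of_hasDerivAt_of_tendsto' (a := 0) (fun z _ => hd z)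
    iB'.integrableOn ht
  rw [P.a_zero, P.b_zero] at h
  norm_num at h
  rw [e1]
  refine mul_nonneg (by norm_num) ?_
  calc (0 : ℝ) = _ := h.symm
    _ ≤ _ := by
      refine setIntegral_mono_on (by simpa using iB'.integrableOn) ig.integrableOn measurableSet_Ioi fun x hx => ?_
      have hi := bb_ineq (le_of_lt (show (0 : ℝ) < x from hx))
      have h1 := W_pos x
      simp only [hg]
      have k1 : 0 ≤ W x * ((a1 x - (y x + bb x) / 100 * a x) ^ 2 + (b1 x - (y x + bb x) / 100 * b x) ^ 2) := by
        positivity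
      have k2 := mul_le_mul_of_nonneg_left hi (show 0 ≤ W x * (a x ^ 2 + b x ^ 2) / 10000 by positivity)
      linarith

end Prof
end VC

namespace VC

open MeasureTheory Real
lemma rpow_split {w r : ℝ} (hw : 0 ≤ w) (hr : 1 < r) : w ^ r = w ^ (r - 1) * w := by
  rcases hw.eq_or_lt with h | h
  · subst h; rw [Real.zero_rpow (by linarith)]; simp
  · rw [Real.rpow_sub_one h.ne']; field_simp

lemma int_comb {f g h k : ℝ → ℝ} (hf : Integrable f) (hg : Integrable g) (hh : Integrable h)
    (hk : Integrable k) : ∫ x, (2 * f x - g x + h x + k x) =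
      2 * (∫ x, f x) - (∫ x, g x) + (∫ x, h x) + ∫ x, k x := by
  have j1 : Integrable (fun x => 2 * f x - g x) := (hf.const_mul 2).sub hg
  have j2 : Integrable (fun x => 2 * f x - g x + h x) := j1.add hh
  rw [integral_add j2 hk, integral_add j1 hh, integral_sub (hf.const_mul 2) hg, integral_const_mul]

namespace Prof

variable {a b a1 b1 : ℝ → ℝ}

lemma N_int (P : Prof a b a1 b1) {r E : ℝ} (hr : 1 < r) (hE : ∀ x, a x ^ 2 + b x ^ 2 ≤ E) :
    Integrable (fun x => W x * (a x ^ 2 + b x ^ 2) ^ r) := by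
  have ca := P.ca
  have cb := P.cb
  have cW := W_cont
  have c1 : Continuous (fun x => (a x ^ 2 + b x ^ 2) ^ r) :=
    Continuous.rpow_const (by fun_prop) fun x => Or.inr (by linarith)
  refine P.integ (by fun_prop) (E ^ (r - 1)) fun x => ?_
  have h1 := W_pos x
  have h2 := W_le x
  have w0 : 0 ≤ a x ^ 2 + b x ^ 2 := by positivity
  rw [rpow_split w0 hr, abs_of_nonneg (by positivity)]
  have h3 : (a x ^ 2 + b x ^ 2) ^ (r - 1) ≤ E ^ (r - 1) :=
    Real.rpow_le_rpow w0 (hE x) (by linarith)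
  have hE0 : 0 ≤ E ^ (r - 1) := le_trans (by positivity) h3
  calc _ ≤ 1 * (E ^ (r - 1) * (a x ^ 2 + b x ^ 2)) := by gcongr
    _ ≤ _ := by
      rw [one_mul]
      exact mul_le_mul_of_nonneg_left (by nlinarith [sq_nonneg (a1 x), sq_nonneg (b1 x)]) hE0

lemma nonlin (P : Prof a b a1 b1) {r κ E : ℝ} (hr : 1 < r) (hκ : 0 < κ) (hκ1 : κ ≤ 1) (hκ2 : κ ≤ 2 * r - 2)
    (hE : ∀ x, a x ^ 2 + b x ^ 2 ≤ E) :
    κ / 2 * (∫ x, W x * (a x ^ 2 + b x ^ 2) ^ r) ≤ 2 * r ^ 2 * 10000 / κ * E ^ (r - 1) *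
    ∫ x, W x * ((a1 x - y x / 100 * a x) ^ 2 + (b1 x - y x / 100 * b x) ^ 2) := by
  have ca := P.ca
  have cb := P.cb
  have ca1 := P.ca1
  have cb1 := P.cb1
  have cW := W_cont
  have cy := y_cont
  have c1 : Continuous (fun x => (a x ^ 2 + b x ^ 2) ^ r) :=
    Continuous.rpow_const (by fun_prop) fun x => Or.inr (by linarith)
  have c2 : Continuous (fun x => (a x ^ 2 + b x ^ 2) ^ (r - 1)) :=
    Continuous.rpow_const (by fun_prop) fun x => Or.inr (by linarith)
  have hd : ∀ x, HasDerivAt (fun x => 100 * y x * W x * (a x ^ 2 + b x ^ 2) ^ r)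
      (W x * (a x ^ 2 + b x ^ 2) ^ (r - 1) * ((1 + (2 * r - 3) * y x ^ 2) * (a x ^ 2 + b x ^ 2) +
        200 * r * y x * (a x * (a1 x - y x / 100 * a x) + b x * (b1 x - y x / 100 * b x)))) x := by
    intro x
    refine HasDerivAt.congr_deriv ((((y_deriv x).const_mul 100).mul (W_deriv x)).mul
      ((P.w_deriv x).rpow_const (p := r) (Or.inr hr.le))) ?_
    rw [rpow_split (by positivity) hr]
    simp only [Pi.mul_apply]
    unfold W
    ring
  have wE : ∀ x, (a x ^ 2 + b x ^ 2) ^ (r - 1) ≤ E ^ (r - 1) := fun x =>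
    Real.rpow_le_rpow (by positivity) (hE x) (by linarith)
  have hE0 : 0 ≤ E ^ (r - 1) := le_trans (by positivity) (wE 0)
  have i1 : Integrable (fun x => 100 * y x * W x * (a x ^ 2 + b x ^ 2) ^ r) := by
    refine ((P.N_int hr hE).const_mul 100).mono' (by fun_prop) (Filter.Eventually.of_forall ?_)
    intro x
    have h1 := W_pos x
    have h2 := y_abs x
    rw [Real.norm_eq_abs, mul_assoc, abs_mul, abs_mul, abs_of_nonneg (show 0 ≤ W x * (a x ^ 2 + b x ^ 2) ^ r by positivity)]
    have h5 : 0 ≤ W x * (a x ^ 2 + b x ^ 2) ^ r := by positivity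
    rw [show |(100 : ℝ)| = 100 by norm_num]
    nlinarith [mul_le_mul_of_nonneg_right h2 h5]
  have i2 : Integrable (fun x => W x * (a x ^ 2 + b x ^ 2) ^ (r - 1) * ((1 + (2 * r - 3) * y x ^ 2) * (a x ^ 2 + b x ^ 2) +
        200 * r * y x * (a x * (a1 x - y x / 100 * a x) + b x * (b1 x - y x / 100 * b x)))) := by
    refine P.integ (by fun_prop) (E ^ (r - 1) * (4 + 1000 * r)) fun x => ?_
    have h1 := W_pos x
    have h2 := W_le x
    have h3 := y_abs x
    have h4 := y_sq_lt x
    have k1 : |(1 + (2 * r - 3) * y x ^ 2)| ≤ 4 + 2 * r := by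
      rw [abs_le]; constructor <;> nlinarith [sq_nonneg (y x)]
    have k2 : |a x * (a1 x - y x / 100 * a x) + b x * (b1 x - y x / 100 * b x)| ≤
        2 * (a x ^ 2 + b x ^ 2 + (a1 x ^ 2 + b1 x ^ 2)) := by
      have h3' := abs_le.1 h3
      rw [abs_le]; constructor <;>
      nlinarith [sq_nonneg (a x + a1 x), sq_nonneg (a x - a1 x),
        sq_nonneg (b x + b1 x), sq_nonneg (b x - b1 x), sq_nonneg (a x), sq_nonneg (b x),
        sq_nonneg (a1 x), sq_nonneg (b1 x),
        mul_nonneg (show 0 ≤ 1 - y x by linarith) (show 0 ≤ a x ^ 2 + b x ^ 2 by positivity),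
        mul_nonneg (show 0 ≤ 1 + y x by linarith) (show 0 ≤ a x ^ 2 + b x ^ 2 by positivity)]
    set S := a x ^ 2 + b x ^ 2 + (a1 x ^ 2 + b1 x ^ 2) with hS
    have wS : a x ^ 2 + b x ^ 2 ≤ S := by nlinarith [sq_nonneg (a1 x), sq_nonneg (b1 x)]
    have S0 : 0 ≤ S := by positivity
    rw [abs_mul, abs_of_nonneg (show 0 ≤ W x * (a x ^ 2 + b x ^ 2) ^ (r - 1) by positivity), mul_assoc]
    have k3 : W x * (a x ^ 2 + b x ^ 2) ^ (r - 1) ≤ E ^ (r - 1) := by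
      calc _ ≤ 1 * E ^ (r - 1) := mul_le_mul h2 (wE x) (by positivity) (by norm_num)
        _ = _ := one_mul _
    have r0 : 0 < r := by linarith
    rw [← mul_assoc]
    have k4 : |(1 + (2 * r - 3) * y x ^ 2) * (a x ^ 2 + b x ^ 2) +
        200 * r * y x * (a x * (a1 x - y x / 100 * a x) + b x * (b1 x - y x / 100 * b x))| ≤
        (4 + 1000 * r) * S := by
      refine (abs_add_le _ _).trans ?_
      rw [abs_mul, abs_mul, abs_mul, abs_of_pos (show 0 < 200 * r by positivity),
        abs_of_nonneg (show 0 ≤ a x ^ 2 + b x ^ 2 by positivity)]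
      calc _ ≤ (4 + 2 * r) * S + 200 * r * 1 * (2 * S) := by gcongr
        _ ≤ _ := by nlinarith [mul_nonneg r0.le S0]
    rw [mul_assoc (E ^ (r - 1))]
    exact mul_le_mul k3 k4 (abs_nonneg _) hE0
  have hz := integral_eq_zero_of_hasDerivAt_of_integrable hd i2 i1
  have hm : ∫ x, κ / 2 * (W x * (a x ^ 2 + b x ^ 2) ^ r) ≤ ∫ x, ((W x * (a x ^ 2 + b x ^ 2) ^ (r - 1) * ((1 + (2 * r - 3) * y x ^ 2) * (a x ^ 2 + b x ^ 2) +
        200 * r * y x * (a x * (a1 x - y x / 100 * a x) + b x * (b1 x - y x / 100 * b x)))) +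
        2 * r ^ 2 * 10000 / κ * E ^ (r - 1) * (W x * ((a1 x - y x / 100 * a x) ^ 2 + (b1 x - y x / 100 * b x) ^ 2))) := by
    refine integral_mono ((P.N_int hr hE).const_mul _) (i2.add (P.Kd_int.const_mul _)) fun x => ?_
    simp only
    have h1 := W_pos x
    have h4 := y_sq_lt x
    have h3 := abs_le.1 (y_abs x)
    rw [rpow_split (by positivity) hr]
    have hw := wE x
    set p := a x
    set q := b x
    set p1 := a1 x - y x / 100 * a x
    set q1 := b1 x - y x / 100 * b x
    set s := (p ^ 2 + q ^ 2) ^ (r - 1) with hs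
    have s0 : 0 ≤ s := by positivity
    have young : ∀ z z1 : ℝ, -(κ / 2 * z ^ 2 + 2 * r ^ 2 * 10000 / κ * z1 ^ 2) ≤
        200 * r * y x * (z * z1) := by
      intro z z1
      have e : 0 ≤ (κ * z + 200 * r * y x * z1) ^ 2 / (2 * κ) := by positivity
      have e2 : (κ * z + 200 * r * y x * z1) ^ 2 / (2 * κ) = κ / 2 * z ^ 2 + 200 * r * y x * (z * z1)
          + y x ^ 2 * (2 * r ^ 2 * 10000 / κ * z1 ^ 2) := by field_simp; ring
      have e3 : y x ^ 2 * (2 * r ^ 2 * 10000 / κ * z1 ^ 2) ≤ 1 * (2 * r ^ 2 * 10000 / κ * z1 ^ 2) :=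
        mul_le_mul_of_nonneg_right h4.le (by positivity)
      linarith
    have y1 := young p p1
    have y2 := young q q1
    have k : κ ≤ 1 + (2 * r - 3) * y x ^ 2 := by nlinarith [sq_nonneg (y x)]
    have k2 := mul_le_mul_of_nonneg_right k (show 0 ≤ p ^ 2 + q ^ 2 by positivity)
    have k3 : κ / 2 * (p ^ 2 + q ^ 2) - 2 * r ^ 2 * 10000 / κ * (p1 ^ 2 + q1 ^ 2) ≤
      (1 + (2 * r - 3) * y x ^ 2) * (p ^ 2 + q ^ 2) + 200 * r * y x * (p * p1 + q * q1) := by linarith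
    have k4 := mul_le_mul_of_nonneg_left k3 (show 0 ≤ W x * s by positivity)
    have k5 := mul_le_mul_of_nonneg_left hw (show 0 ≤ 2 * r ^ 2 * 10000 / κ * (W x * (p1 ^ 2 + q1 ^ 2)) by positivity)
    linarith
  rw [integral_add i2 (P.Kd_int.const_mul _), hz, integral_const_mul, integral_const_mul] at hm
  linarith

lemma main_int (P : Prof a b a1 b1) {r E C₀ : ℝ} (hr : 1 < r) (hC : 0 ≤ C₀) (hE : ∀ x, a x ^ 2 + b x ^ 2 ≤ E)
    {nl : ℝ → ℝ} (cnl : Continuous nl) (hnl : ∀ x, |nl x| ≤ 2 * C₀ * (a x ^ 2 + b x ^ 2) ^ r) :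
    Integrable nl ∧ Integrable (fun x => W x * nl x) := by
  have cW := W_cont
  have h : Integrable nl := by
    refine P.integ cnl (2 * C₀ * E ^ (r - 1)) fun x => (hnl x).trans ?_
    rw [rpow_split (by positivity) hr, mul_assoc (2 * C₀)]
    have h3 : (a x ^ 2 + b x ^ 2) ^ (r - 1) ≤ E ^ (r - 1) :=
      Real.rpow_le_rpow (by positivity) (hE x) (by linarith)
    have hE0 : 0 ≤ E ^ (r - 1) := le_trans (by positivity) h3
    refine mul_le_mul_of_nonneg_left (mul_le_mul h3 ?_ (by positivity) hE0) (by positivity)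
    nlinarith [sq_nonneg (a1 x), sq_nonneg (b1 x)]
  refine ⟨h, h.norm.mono' (by fun_prop) (Filter.Eventually.of_forall fun x => ?_)⟩
  rw [norm_mul, Real.norm_eq_abs (W x), abs_of_pos (W_pos x)]
  exact mul_le_of_le_one_left (norm_nonneg _) (W_le x)

set_option maxHeartbeats 1000000 in
lemma coer (P : Prof a b a1 b1) {r κ E C₀ : ℝ} (hr : 1 < r) (hκ : 0 < κ) (hκ1 : κ ≤ 1) (hκ2 : κ ≤ 2 * r - 2)
    (hC : 0 ≤ C₀) (hE : ∀ x, a x ^ 2 + b x ^ 2 ≤ E)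
    {nl : ℝ → ℝ} (cnl : Continuous nl) (hnl : ∀ x, |nl x| ≤ 2 * C₀ * (a x ^ 2 + b x ^ 2) ^ r)
    (hsmall : 2 * C₀ * (4 * r ^ 2 * 10000 / κ ^ 2) * E ^ (r - 1) ≤ 1 / 8) :
    1 / 100000 * (∫ x, 1 / Real.cosh x * ((a1 x ^ 2 + b1 x ^ 2) + (a x ^ 2 + b x ^ 2))) ≤
    ∫ x, (W x * (2 * (a1 x ^ 2 + b1 x ^ 2) + nl x) +
      (-(2 * y x * W x / 100)) * (a x * a1 x + b x * b1 x)) := by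
  have ca := P.ca
  have cb := P.cb
  have ca1 := P.ca1
  have cb1 := P.cb1
  have cW := W_cont
  have cy := y_cont
  have iK := P.Kd_int
  have iM := P.Md_int
  have iN := P.N_int hr hE
  obtain ⟨-, iL⟩ := P.main_int hr hC hE cnl hnl
  have hN := P.nonlin hr hκ hκ1 hκ2 hE
  have hH := P.hardy
  set K := ∫ x, W x * ((a1 x - y x / 100 * a x) ^ 2 + (b1 x - y x / 100 * b x) ^ 2) with hKdef
  set M := ∫ x, W x ^ 2 * (a x ^ 2 + b x ^ 2) / 10000 with hMdef
  set N := ∫ x, W x * (a x ^ 2 + b x ^ 2) ^ r with hNdef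
  have K0 : 0 ≤ K := integral_nonneg fun x => by have := W_pos x; simp only [Pi.zero_apply]; positivity
  have M0 : 0 ≤ M := integral_nonneg fun x => by have := W_pos x; simp only [Pi.zero_apply]; positivity
  -- left-hand side
  have hL : (∫ x, 1 / Real.cosh x * ((a1 x ^ 2 + b1 x ^ 2) + (a x ^ 2 + b x ^ 2))) ≤
      2 * K + 20000 * M := by
    rw [hKdef, hMdef, ← integral_const_mul, ← integral_const_mul,
      ← integral_add (iK.const_mul _) (iM.const_mul _)]
    refine integral_mono_of_nonneg (Filter.Eventually.of_forall fun x => ?_)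
      ((iK.const_mul _).add (iM.const_mul _)) (Filter.Eventually.of_forall fun x => ?_)
    · have := Real.cosh_pos x
      simp only [Pi.zero_apply]; positivity
    · simp only
      have h1 := W_pos x
      have h2 := W_le x
      have h4 := y_sq_lt x
      have h5 := sech_le x
      have sq : ∀ p q : ℝ, q ^ 2 + p ^ 2 ≤ 2 * (q - y x / 100 * p) ^ 2 + 2 * p ^ 2 := by
        intro p q
        have : (y x / 100 * p) ^ 2 ≤ 1 / 2 * p ^ 2 := by
          rw [mul_pow, div_pow]
          exact mul_le_mul_of_nonneg_right (by linarith) (sq_nonneg p)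
        nlinarith [sq_nonneg (q - 2 * (y x / 100 * p))]
      have q1 := sq (a x) (a1 x)
      have q2 := sq (b x) (b1 x)
      set da := (a1 x - y x / 100 * a x) ^ 2 + (b1 x - y x / 100 * b x) ^ 2 with hda
      have d0 : 0 ≤ da := by positivity
      calc _ ≤ W x ^ 2 * (2 * da + 2 * (a x ^ 2 + b x ^ 2)) :=
            mul_le_mul h5 (by linarith) (by positivity) (by positivity)
        _ ≤ _ := by nlinarith [mul_nonneg (mul_nonneg h1.le (sub_nonneg.2 h2)) d0]
  -- right-hand side
  have hd : ∀ x, HasDerivAt (fun x => y x / 100 * W x * (a x ^ 2 + b x ^ 2))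
      ((W x ^ 2 - 2 * y x ^ 2 * W x) / 10000 * (a x ^ 2 + b x ^ 2)
        + y x / 100 * W x * (2 * (a x * a1 x + b x * b1 x))) x := by
    intro x
    refine HasDerivAt.congr_deriv ((((y_deriv x).div_const 100).mul (W_deriv x)).mul (P.w_deriv x)) ?_
    simp only [Pi.mul_apply]
    ring
  have bd : ∀ x, |y x / 100 * W x| ≤ 1 := fun x => by
    rw [abs_mul, abs_div, abs_of_pos (W_pos x)]
    have h2 := W_le x
    have h3 := y_abs x
    have h1 := W_pos x
    rw [show |(100 : ℝ)| = 100 by norm_num]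
    nlinarith [abs_nonneg (y x)]
  have i1 : Integrable (fun x => y x / 100 * W x * (a x ^ 2 + b x ^ 2)) := by
    refine P.integ (by fun_prop) 1 fun x => ?_
    rw [abs_mul, abs_of_nonneg (show 0 ≤ a x ^ 2 + b x ^ 2 by positivity)]
    refine mul_le_mul (bd x) ?_ (by positivity) (by norm_num)
    nlinarith [sq_nonneg (a1 x), sq_nonneg (b1 x)]
  have i2 : Integrable (fun x => (W x ^ 2 - 2 * y x ^ 2 * W x) / 10000 * (a x ^ 2 + b x ^ 2)
        + y x / 100 * W x * (2 * (a x * a1 x + b x * b1 x))) := by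
    refine P.integ (by fun_prop) 4 fun x => ?_
    have h1 := W_pos x
    have h2 := W_le x
    have h4 := y_sq_lt x
    have e1 : |(W x ^ 2 - 2 * y x ^ 2 * W x) / 10000| ≤ 1 := by
      rw [abs_le]; constructor <;> nlinarith [sq_nonneg (y x), mul_nonneg (sq_nonneg (y x)) h1.le]
    have e2 : |2 * (a x * a1 x + b x * b1 x)| ≤ a x ^ 2 + b x ^ 2 + (a1 x ^ 2 + b1 x ^ 2) := by
      rw [abs_le]; constructor <;>
      nlinarith [sq_nonneg (a x + a1 x), sq_nonneg (a x - a1 x),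
        sq_nonneg (b x + b1 x), sq_nonneg (b x - b1 x)]
    refine (abs_add_le _ _).trans ?_
    rw [abs_mul, abs_mul (y x / 100 * W x), abs_of_nonneg (show 0 ≤ a x ^ 2 + b x ^ 2 by positivity)]
    have e3 := mul_le_mul e1 le_rfl (show 0 ≤ a x ^ 2 + b x ^ 2 by positivity) (by norm_num)
    have e4 := mul_le_mul (bd x) e2 (abs_nonneg _) (by norm_num)
    nlinarith [sq_nonneg (a1 x), sq_nonneg (b1 x), sq_nonneg (a x), sq_nonneg (b x)]
  have hz := integral_eq_zero_of_hasDerivAt_of_integrable hd i2 i1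
  have hR : ∫ x, (W x * (2 * (a1 x ^ 2 + b1 x ^ 2) + nl x) +
      (-(2 * y x * W x / 100)) * (a x * a1 x + b x * b1 x)) = 2 * K - M + ∫ x, W x * nl x := by
    have hc := int_comb iK iM iL i2
    rw [hz, add_zero] at hc
    rw [hKdef, hMdef, ← hc]
    refine integral_congr_ae (Filter.Eventually.of_forall fun x => ?_)
    simp only
    unfold W
    ring
  have hNL : -(2 * C₀ * N) ≤ ∫ x, W x * nl x := by
    rw [hNdef, ← integral_const_mul, ← integral_neg]
    refine integral_mono (iN.const_mul _).neg iL fun x => ?_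
    have := (abs_le.1 (hnl x)).1
    have := mul_le_mul_of_nonneg_left this (W_pos x).le
    simp only
    linarith
  have hN2 : 2 * C₀ * N ≤ 1 / 8 * K := by
    have e1 := mul_le_mul_of_nonneg_left hN (show 0 ≤ 2 * C₀ * (2 / κ) by positivity)
    have e2 := mul_le_mul_of_nonneg_right hsmall K0
    have e3 : 2 * C₀ * (2 / κ) * (κ / 2 * N) = 2 * C₀ * N := by field_simp
    have e4 : 2 * C₀ * (2 / κ) * (2 * r ^ 2 * 10000 / κ * E ^ (r - 1) * K) =
      2 * C₀ * (4 * r ^ 2 * 10000 / κ ^ 2) * E ^ (r - 1) * K := by field_simp; ring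
    linarith
  rw [hR]
  linarith

end Prof
end VC

namespace VC

open MeasureTheory Real Filter Topology

lemma cont_fw {r C₀ : ℝ} (hr : 1 < r) {f : ℝ → ℝ}
    (hf : ∀ s : ℝ, 0 ≤ s → |f s| ≤ C₀ * s ^ (r - 1)) {a b na nb : ℝ → ℝ}
    (ca : Continuous a) (cb : Continuous b) (cna : Continuous na) (cnb : Continuous nb)
    (ha : ∀ x, f (a x ^ 2 + b x ^ 2) * a x = na x) (hb : ∀ x, f (a x ^ 2 + b x ^ 2) * b x = nb x) :
    Continuous (fun x => f (a x ^ 2 + b x ^ 2)) := by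
  rw [continuous_iff_continuousAt]
  intro x₀
  have cw : Continuous (fun x => a x ^ 2 + b x ^ 2) := by fun_prop
  by_cases h0 : a x₀ ^ 2 + b x₀ ^ 2 = 0
  · have hf0 : f 0 = 0 := by
      have := hf 0 le_rfl
      rw [Real.zero_rpow (by linarith), mul_zero] at this
      exact abs_eq_zero.1 (le_antisymm this (abs_nonneg _))
    show Tendsto (fun x => f (a x ^ 2 + b x ^ 2)) (𝓝 x₀) (𝓝 (f (a x₀ ^ 2 + b x₀ ^ 2)))
    rw [h0, hf0]
    have c1 : Continuous (fun x => C₀ * (a x ^ 2 + b x ^ 2) ^ (r - 1)) :=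
      continuous_const.mul (cw.rpow_const fun x => Or.inr (by linarith))
    have t1 := c1.tendsto x₀
    rw [h0, Real.zero_rpow (by linarith), mul_zero] at t1
    exact squeeze_zero_norm (fun x => hf _ (by positivity)) t1
  · have c1 : ContinuousAt (fun x => (a x * na x + b x * nb x) / (a x ^ 2 + b x ^ 2)) x₀ :=
      ContinuousAt.div (by fun_prop) cw.continuousAt h0
    refine c1.congr ?_
    filter_upwards [cw.continuousAt.eventually_ne h0] with x hx
    rw [← ha, ← hb]
    field_simp

lemma f_contOn {f w : ℝ → ℝ} (cw : Continuous w) (cf : Continuous (fun x => f (w x)))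
    (s : Set ℝ) (hs : IsCompact s) : ContinuousOn f (w '' s) := by
  rw [continuousOn_iff_isClosed]
  intro t ht
  refine ⟨w '' (s ∩ (fun x => f (w x)) ⁻¹' t), ?_, ?_⟩
  · exact ((hs.inter_right (ht.preimage cf)).image cw).isClosed
  · ext z
    constructor
    · rintro ⟨hz, x, hx, rfl⟩
      exact ⟨⟨x, ⟨hx, hz⟩, rfl⟩, ⟨x, hx, rfl⟩⟩
    · rintro ⟨⟨x, ⟨hx, hz⟩, rfl⟩, -⟩
      exact ⟨hz, ⟨x, hx, rfl⟩⟩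

lemma H_bound {r C₀ : ℝ} (hr : 1 < r) (hC : 0 ≤ C₀) {f : ℝ → ℝ}
    (hf : ∀ s : ℝ, 0 ≤ s → |f s| ≤ C₀ * s ^ (r - 1)) {w w1 : ℝ → ℝ}
    (hw : ∀ x, HasDerivAt w (w1 x) x) (cw1 : Continuous w1) (w0 : w 0 = 0) (wn : ∀ x, 0 ≤ w x)
    (cf : Continuous (fun x => f (w x))) (x : ℝ) :
    |∫ z in (0 : ℝ)..x, f (w z) * w1 z| ≤ C₀ * w x ^ r := by
  have cw : Continuous w := continuous_iff_continuousAt.2 fun x => (hw x).continuousAt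
  have h := intervalIntegral.integral_comp_mul_deriv' (a := 0) (b := x) (g := f) (fun z _ => hw z)
    cw1.continuousOn (f_contOn cw cf _ isCompact_uIcc)
  simp only [Function.comp_apply] at h
  rw [h, w0]
  have : ‖∫ z in (0 : ℝ)..w x, f z‖ ≤ C₀ * w x ^ (r - 1) * |w x - 0| := by
    refine intervalIntegral.norm_integral_le_of_norm_le_const fun z hz => ?_
    rw [Set.uIoc_of_le (wn x)] at hz
    refine (hf z hz.1.le).trans ?_
    exact mul_le_mul_of_nonneg_left (Real.rpow_le_rpow hz.1.le hz.2 (by linarith)) hC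
  rw [sub_zero, abs_of_nonneg (wn x), mul_assoc, ← rpow_split (wn x) hr] at this
  exact this

/-- Partial derivatives of a smooth function of `(t, x)`. -/
lemma partials {A : ℝ → ℝ → ℝ} (hA : ContDiff ℝ (⊤ : ℕ∞) (Function.uncurry A)) :
    ∃ Ax At Axt : ℝ → ℝ → ℝ,
      ContDiff ℝ (⊤ : ℕ∞) (Function.uncurry Ax) ∧ ContDiff ℝ (⊤ : ℕ∞) (Function.uncurry At) ∧
      Continuous (Function.uncurry Axt) ∧
      (∀ t x, HasDerivAt (A t) (Ax t x) x) ∧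
      (∀ t x, HasDerivAt (fun s => A s x) (At t x) t) ∧
      (∀ t x, HasDerivAt (At t) (Axt t x) x) ∧
      (∀ t x, HasDerivAt (fun s => Ax s x) (Axt t x) t) := by
  have px : ∀ (B : ℝ → ℝ → ℝ), ContDiff ℝ (⊤ : ℕ∞) (Function.uncurry B) → ∀ t x,
      HasDerivAt (B t) (fderiv ℝ (Function.uncurry B) (t, x) (0, 1)) x := by
    intro B hB t x
    have h1 : HasFDerivAt (Function.uncurry B) (fderiv ℝ (Function.uncurry B) (t, x)) (t, x) :=
      (hB.differentiable (by simp) (t, x)).hasFDerivAt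
    have h2 : HasDerivAt (fun x : ℝ => (t, x)) ((0 : ℝ), (1 : ℝ)) x :=
      (hasDerivAt_const x t).prodMk (hasDerivAt_id x)
    exact h1.comp_hasDerivAt x h2
  have pt : ∀ (B : ℝ → ℝ → ℝ), ContDiff ℝ (⊤ : ℕ∞) (Function.uncurry B) → ∀ t x,
      HasDerivAt (fun s => B s x) (fderiv ℝ (Function.uncurry B) (t, x) (1, 0)) t := by
    intro B hB t x
    have h1 : HasFDerivAt (Function.uncurry B) (fderiv ℝ (Function.uncurry B) (t, x)) (t, x) :=
      (hB.differentiable (by simp) (t, x)).hasFDerivAt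
    have h2 : HasDerivAt (fun t : ℝ => (t, x)) ((1 : ℝ), (0 : ℝ)) t :=
      (hasDerivAt_id t).prodMk (hasDerivAt_const t x)
    exact h1.comp_hasDerivAt t h2
  have cd : ∀ (B : ℝ × ℝ → ℝ), ContDiff ℝ (⊤ : ℕ∞) B → ∀ v : ℝ × ℝ,
      ContDiff ℝ (⊤ : ℕ∞) (fun q => fderiv ℝ B q v) := by
    intro B hB v
    exact (hB.fderiv_right (m := (⊤ : ℕ∞)) (by simp)).clm_apply contDiff_const
  set U := Function.uncurry A with hU
  have sx : ContDiff ℝ (⊤ : ℕ∞) (Function.uncurry (fun t x => fderiv ℝ U (t, x) (0, 1))) :=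
    cd U hA (0, 1)
  have st : ContDiff ℝ (⊤ : ℕ∞) (Function.uncurry (fun t x => fderiv ℝ U (t, x) (1, 0))) :=
    cd U hA (1, 0)
  have symm : ∀ q : ℝ × ℝ, fderiv ℝ (fun q => fderiv ℝ U q (1, 0)) q (0, 1) =
      fderiv ℝ (fun q => fderiv ℝ U q (0, 1)) q (1, 0) := by
    intro q
    have hs : IsSymmSndFDerivAt ℝ U q := (hA.contDiffAt).isSymmSndFDerivAt (by simp only [minSmoothness_of_isRCLikeNormedField]; exact WithTop.coe_le_coe.2 (le_top : (2:ℕ∞) ≤ ⊤))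
    have hd : DifferentiableAt ℝ (fderiv ℝ U) q :=
      (hA.fderiv_right (m := (⊤ : ℕ∞)) (by simp)).differentiable (by simp) q
    have e : ∀ v u : ℝ × ℝ, fderiv ℝ (fun q => fderiv ℝ U q v) q u = fderiv ℝ (fderiv ℝ U) q u v := by
      intro v u
      rw [fderiv_clm_apply hd (differentiableAt_const v)]
      simp
    rw [e, e]
    exact hs.eq _ _
  refine ⟨fun t x => fderiv ℝ U (t, x) (0, 1), fun t x => fderiv ℝ U (t, x) (1, 0),
    fun t x => fderiv ℝ (fun q => fderiv ℝ U q (1, 0)) (t, x) (0, 1), sx, st,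
    (cd _ st (0, 1)).continuous, px A hA, pt A hA, ?_, ?_⟩
  · exact px _ st
  · intro t x
    have := pt _ sx t x
    refine this.congr_deriv ?_
    exact (symm (t, x)).symm

/-- differentiation under the integral sign on a compact interval -/
lemma diff_int {M Mt : ℝ → ℝ → ℝ} (cM : Continuous (Function.uncurry M))
    (cMt : Continuous (Function.uncurry Mt)) (h : ∀ t x, HasDerivAt (fun s => M s x) (Mt t x) t)
    (α β t : ℝ) : HasDerivAt (fun s => ∫ x in α..β, M s x) (∫ x in α..β, Mt t x) t := by
  obtain ⟨K, hK⟩ := ((isCompact_Icc (a := t - 1) (b := t + 1)).prod (isCompact_uIcc (a := α) (b := β))).exists_bound_of_continuousOn cMt.continuousOn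
  have c1 : ∀ s, Continuous (M s) := fun s => cM.comp (by fun_prop : Continuous fun x : ℝ => (s, x))
  have c2 : ∀ s, Continuous (Mt s) := fun s => cMt.comp (by fun_prop : Continuous fun x : ℝ => (s, x))
  refine (intervalIntegral.hasDerivAt_integral_of_dominated_loc_of_deriv_le (F' := Mt) (bound := fun _ => K)
    (Icc_mem_nhds (by linarith : t - 1 < t) (by linarith : t < t + 1)) ?_ ?_ ?_ ?_ ?_ ?_).2
  · exact Eventually.of_forall fun s => (c1 s).aestronglyMeasurable
  · exact (c1 t).intervalIntegrable _ _
  · exact (c2 t).aestronglyMeasurable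
  · refine Eventually.of_forall fun x hx s hs => hK (s, x) ⟨hs, Set.uIoc_subset_uIcc hx⟩
  · exact intervalIntegrable_const
  · exact Eventually.of_forall fun x _ s _ => h s x

end VC

namespace VC

open MeasureTheory Real Filter Topology

/-- the cutoff, vanishing to second order at `±R` -/
noncomputable def chi (R x : ℝ) : ℝ := (1 - x ^ 2 / R ^ 2) ^ 2
/-- derivative of the cutoff -/
noncomputable def chi1 (R x : ℝ) : ℝ := -(4 * x / R ^ 2) * (1 - x ^ 2 / R ^ 2)
/-- second derivative of the cutoff -/
noncomputable def chi2 (R x : ℝ) : ℝ := -(4 / R ^ 2) + 12 * x ^ 2 / R ^ 4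
/-- truncated weight -/
noncomputable def psi (R x : ℝ) : ℝ := chi R x * (100 * y x)
/-- its derivative -/
noncomputable def psi1 (R x : ℝ) : ℝ := chi1 R x * (100 * y x) + chi R x * W x
/-- its second derivative -/
noncomputable def psi2 (R x : ℝ) : ℝ :=
  chi2 R x * (100 * y x) + 2 * chi1 R x * W x + chi R x * (-(2 * y x * W x / 100))

lemma chi_deriv {R : ℝ} (x : ℝ) : HasDerivAt (chi R) (chi1 R x) x := by
  have h := (((((hasDerivAt_id x).pow 2).div_const (R ^ 2)).const_sub 1).pow 2)
  refine HasDerivAt.congr_deriv h ?_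
  simp [chi1]; ring

lemma chi1_deriv {R : ℝ} (hR : 0 < R) (x : ℝ) : HasDerivAt (chi1 R) (chi2 R x) x := by
  have h := ((((hasDerivAt_id x).pow 2).div_const (R ^ 2)).const_sub 1)
  have h2 := ((((hasDerivAt_id x).const_mul 4).div_const (R ^ 2)).neg).mul h
  refine HasDerivAt.congr_deriv h2 ?_
  simp [chi2]; field_simp; ring

lemma psi_deriv {R : ℝ} (x : ℝ) : HasDerivAt (psi R) (psi1 R x) x := by
  have h := (chi_deriv (R := R) x).mul ((y_deriv x).const_mul 100)
  refine HasDerivAt.congr_deriv h ?_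
  unfold psi1; ring

lemma psi1_deriv {R : ℝ} (hR : 0 < R) (x : ℝ) : HasDerivAt (psi1 R) (psi2 R x) x := by
  have h := ((chi1_deriv hR x).mul ((y_deriv x).const_mul 100)).add
    ((chi_deriv (R := R) x).mul (W_deriv x))
  refine HasDerivAt.congr_deriv h ?_
  simp [psi2]; ring

lemma chi_cont (R : ℝ) : Continuous (chi R) := by unfold chi; fun_prop
lemma chi1_cont (R : ℝ) : Continuous (chi1 R) := by unfold chi1; fun_prop
lemma chi2_cont (R : ℝ) : Continuous (chi2 R) := by unfold chi2; fun_prop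
lemma psi_cont (R : ℝ) : Continuous (psi R) := by
  have := chi_cont R; have := y_cont; unfold psi; fun_prop
lemma psi1_cont (R : ℝ) : Continuous (psi1 R) := by
  have := chi_cont R; have := chi1_cont R; have := y_cont; have := W_cont; unfold psi1; fun_prop
lemma psi2_cont (R : ℝ) : Continuous (psi2 R) := by
  have := chi_cont R; have := chi1_cont R; have := chi2_cont R
  have := y_cont; have := W_cont; unfold psi2; fun_prop

lemma psi_R {R : ℝ} (hR : 0 < R) : psi R R = 0 ∧ psi R (-R) = 0 ∧ psi1 R R = 0 ∧ psi1 R (-R) = 0 := by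
  have h : R ^ 2 / R ^ 2 = 1 := by field_simp
  simp [psi, psi1, chi, chi1, h]

lemma cut_in {R x : ℝ} (hR : 1 ≤ R) (hx : |x| ≤ R) :
    0 ≤ chi R x ∧ chi R x ≤ 1 ∧ (1 - chi R x) * W x ≤ 20000 / R ∧ |chi1 R x| ≤ 4 / R ∧
      |chi2 R x| ≤ 16 / R := by
  have R0 : 0 < R := by linarith
  have hx2 : x ^ 2 ≤ R ^ 2 := by rw [← sq_abs x]; gcongr
  set q := x ^ 2 / R ^ 2 with hq
  have q0 : 0 ≤ q := by positivity
  have q1 : q ≤ 1 := by rw [hq, div_le_one (by positivity)]; exact hx2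
  have inv2 : 1 / R ^ 2 ≤ 1 / R := by
    apply one_div_le_one_div_of_le R0; nlinarith
  refine ⟨by unfold chi; positivity, ?_, ?_, ?_, ?_⟩
  · unfold chi; rw [← hq]; nlinarith
  · have h1 : 1 - chi R x ≤ 2 * q := by unfold chi; rw [← hq]; nlinarith
    calc (1 - chi R x) * W x ≤ 2 * q * W x := by gcongr; exact (W_pos x).le
      _ = 2 * (x ^ 2 * W x) * (1 / R ^ 2) := by rw [hq]; ring
      _ ≤ 2 * 10000 * (1 / R) := by
          have := x_sq_W x
          gcongr
      _ = 20000 / R := by ring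
  · unfold chi1
    rw [← hq, abs_mul, abs_neg, abs_of_nonneg (by linarith : 0 ≤ 1 - q), abs_div, abs_mul,
      abs_of_pos (by positivity : 0 < R ^ 2), abs_of_pos (by norm_num : (0 : ℝ) < 4)]
    calc 4 * |x| / R ^ 2 * (1 - q) ≤ 4 * R / R ^ 2 * 1 := by gcongr; linarith
      _ = 4 / R := by field_simp
  · have : chi2 R x = (12 * q - 4) * (1 / R ^ 2) := by unfold chi2; rw [hq]; field_simp; ring
    rw [this, abs_mul, abs_of_pos (by positivity : 0 < 1 / R ^ 2)]
    calc |12 * q - 4| * (1 / R ^ 2) ≤ 16 * (1 / R) := by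
          gcongr
          rw [abs_le]; constructor <;> linarith
      _ = 16 / R := by ring

lemma yW_abs (x : ℝ) : |(-(2 * y x * W x / 100))| ≤ W x := by
  have hy := y_abs x
  have hW := W_pos x
  rw [abs_neg, abs_div, abs_mul, abs_mul, abs_of_pos hW, abs_of_pos (by norm_num : (0 : ℝ) < 100),
    abs_of_pos (by norm_num : (0 : ℝ) < 2)]
  nlinarith [abs_nonneg (y x)]

lemma cut_bound {R : ℝ} (hR : 1 ≤ R) (x : ℝ) :
    |(Set.Ioc (-R) R).indicator (psi1 R) x - W x| ≤ 100000 / R ∧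
    |(Set.Ioc (-R) R).indicator (psi2 R) x - (-(2 * y x * W x / 100))| ≤ 100000 / R := by
  have R0 : 0 < R := by linarith
  have hy := y_abs x
  have hW := W_pos x
  have hW1 := W_le x
  by_cases hx : x ∈ Set.Ioc (-R) R
  · rw [Set.indicator_of_mem hx, Set.indicator_of_mem hx]
    obtain ⟨c0, c1, cW, d1, d2⟩ := cut_in hR (abs_le.2 ⟨hx.1.le, hx.2⟩)
    have e0 : |(1 - chi R x) * W x| ≤ 20000 / R := by
      rw [abs_of_nonneg (mul_nonneg (by linarith) hW.le)]; exact cW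
    have e1 : |chi1 R x * y x| ≤ 4 / R := by
      rw [abs_mul]
      calc _ ≤ 4 / R * 1 := by gcongr
        _ = _ := by ring
    have e2 : |chi2 R x * y x| ≤ 16 / R := by
      rw [abs_mul]
      calc _ ≤ 16 / R * 1 := by gcongr
        _ = _ := by ring
    have e3 : |chi1 R x * W x| ≤ 4 / R := by
      rw [abs_mul, abs_of_pos hW]
      calc _ ≤ 4 / R * 1 := by gcongr
        _ = _ := by ring
    have e4 : |(1 - chi R x) * W x * y x| ≤ 20000 / R := by
      rw [abs_mul]
      calc _ ≤ 20000 / R * 1 := by gcongr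
        _ = _ := by ring
    have i0 : 0 < 1 / R := by positivity
    rw [show 20000 / R = 20000 * (1 / R) by ring] at e0 e4
    rw [show 4 / R = 4 * (1 / R) by ring] at e1 e3
    rw [show 16 / R = 16 * (1 / R) by ring] at e2
    rw [show 100000 / R = 100000 * (1 / R) by ring]
    rw [abs_le] at e0 e1 e2 e3 e4
    constructor
    · rw [show psi1 R x - W x = 100 * (chi1 R x * y x) - (1 - chi R x) * W x by unfold psi1; ring,
        abs_le]
      constructor <;> linarith
    · rw [show psi2 R x - (-(2 * y x * W x / 100)) = 100 * (chi2 R x * y x) + 2 * (chi1 R x * W x)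
        + (1 - chi R x) * W x * y x / 50 by unfold psi2; ring, abs_le]
      constructor <;> linarith
  · rw [Set.indicator_of_notMem hx, Set.indicator_of_notMem hx]
    have hx2 : R ^ 2 ≤ x ^ 2 := by
      rw [Set.mem_Ioc, not_and_or, not_lt, not_le] at hx
      rcases hx with h | h <;> nlinarith
    have hb : W x ≤ 100000 / R := by
      rw [le_div_iff₀ R0]
      have := x_sq_W x
      nlinarith
    constructor
    · rw [zero_sub, abs_neg, abs_of_pos hW]; exact hb
    · rw [zero_sub, abs_neg]; exact (yW_abs x).trans hb

lemma cut_err {E1 E2 S : ℝ → ℝ} (c1 : Continuous E1) (c2 : Continuous E2) (hS : Integrable S)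
    (h : ∀ x, |E1 x| + |E2 x| ≤ S x) {R : ℝ} (hR : 1 ≤ R) :
    |(∫ x in (-R)..R, (psi1 R x * E1 x + psi2 R x * E2 x)) -
      ∫ x, (W x * E1 x + (-(2 * y x * W x / 100)) * E2 x)| ≤ 100000 / R * ∫ x, S x := by
  have R0 : 0 < R := by linarith
  have i1 : Integrable E1 := hS.mono' c1.aestronglyMeasurable
    (Eventually.of_forall fun x => by have := h x; have := abs_nonneg (E2 x); rw [Real.norm_eq_abs]; linarith)
  have i2 : Integrable E2 := hS.mono' c2.aestronglyMeasurable
    (Eventually.of_forall fun x => by have := h x; have := abs_nonneg (E1 x); rw [Real.norm_eq_abs]; linarith)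
  have cW := W_cont
  have cy := y_cont
  have j2 : Integrable (fun x => W x * E1 x + (-(2 * y x * W x / 100)) * E2 x) := by
    refine hS.mono' (by fun_prop) (Eventually.of_forall fun x => ?_)
    refine (norm_add_le _ _).trans ?_
    rw [Real.norm_eq_abs, Real.norm_eq_abs, abs_mul, abs_mul, abs_of_pos (W_pos x)]
    have := (yW_abs x).trans (W_le x)
    have := W_le x
    have := h x
    nlinarith [abs_nonneg (E1 x), abs_nonneg (E2 x)]
  have p1 := psi1_cont R
  have p2 := psi2_cont R
  rw [intervalIntegral.integral_of_le (by linarith), ← integral_indicator measurableSet_Ioc,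
    ← integral_sub ?_ j2, ← Real.norm_eq_abs, ← integral_const_mul]
  · refine norm_integral_le_of_norm_le (hS.const_mul _) (Eventually.of_forall fun x => ?_)
    obtain ⟨b1, b2⟩ := cut_bound hR x
    have e : (Set.Ioc (-R) R).indicator (fun x => psi1 R x * E1 x + psi2 R x * E2 x) x =
      (Set.Ioc (-R) R).indicator (psi1 R) x * E1 x + (Set.Ioc (-R) R).indicator (psi2 R) x * E2 x := by
      by_cases hx : x ∈ Set.Ioc (-R) R <;> simp [hx]
    rw [e, show ∀ p q a b c d : ℝ, p * a + q * b - (c * a + d * b) = (p - c) * a + (q - d) * b from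
      fun _ _ _ _ _ _ => by ring]
    refine (norm_add_le _ _).trans ?_
    rw [Real.norm_eq_abs, Real.norm_eq_abs, abs_mul, abs_mul]
    calc _ ≤ 100000 / R * |E1 x| + 100000 / R * |E2 x| := by gcongr
      _ = 100000 / R * (|E1 x| + |E2 x|) := by ring
      _ ≤ _ := by
        have := h x
        gcongr
  · rw [integrable_indicator_iff measurableSet_Ioc]
    exact ((p1.mul c1).add (p2.mul c2)).integrableOn_Icc.mono_set Set.Ioc_subset_Icc_self

lemma cut_tendsto {M : ℝ → ℝ} (cM : Continuous M) (hM : Integrable M) :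
    Tendsto (fun n : ℕ => ∫ x in (-((n : ℝ) + 1))..((n : ℝ) + 1), psi ((n : ℝ) + 1) x * M x) atTop
      (𝓝 (∫ x, 100 * y x * M x)) := by
  have e : (fun n : ℕ => ∫ x in (-((n : ℝ) + 1))..((n : ℝ) + 1), psi ((n : ℝ) + 1) x * M x) =
      fun n : ℕ => ∫ x, (Set.Ioc (-((n : ℝ) + 1)) ((n : ℝ) + 1)).indicator
        (fun x => psi ((n : ℝ) + 1) x * M x) x := by
    funext n
    have : (0 : ℝ) ≤ n := n.cast_nonneg
    rw [intervalIntegral.integral_of_le (by linarith), integral_indicator measurableSet_Ioc]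
  rw [e]
  have tn : Tendsto (fun n : ℕ => (n : ℝ) + 1) atTop atTop :=
    tendsto_atTop_add_const_right _ _ tendsto_natCast_atTop_atTop
  refine tendsto_integral_of_dominated_convergence (fun x => 100 * |M x|) ?_ (hM.abs.const_mul 100) ?_ ?_
  · intro n
    exact (((psi_cont _).mul cM).aestronglyMeasurable).indicator measurableSet_Ioc
  · intro n
    refine Eventually.of_forall fun x => ?_
    have : (0 : ℝ) ≤ n := n.cast_nonneg
    by_cases hx : x ∈ Set.Ioc (-((n : ℝ) + 1)) ((n : ℝ) + 1)
    · rw [Set.indicator_of_mem hx, Real.norm_eq_abs, abs_mul]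
      obtain ⟨c0, c1, -⟩ := cut_in (R := (n : ℝ) + 1) (by linarith) (abs_le.2 ⟨hx.1.le, hx.2⟩)
      have hy := y_abs x
      gcongr
      unfold psi
      rw [abs_mul, abs_of_nonneg c0, abs_mul, abs_of_pos (by norm_num : (0 : ℝ) < 100)]
      nlinarith [abs_nonneg (y x)]
    · rw [Set.indicator_of_notMem hx]; simp
  · refine Eventually.of_forall fun x => ?_
    have t1 : Tendsto (fun n : ℕ => psi ((n : ℝ) + 1) x * M x) atTop (𝓝 (100 * y x * M x)) := by
      refine Tendsto.mul_const _ ?_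
      have t2 : Tendsto (fun n : ℕ => x ^ 2 / ((n : ℝ) + 1) ^ 2) atTop (𝓝 0) :=
        Tendsto.div_atTop tendsto_const_nhds ((tendsto_pow_atTop (by norm_num)).comp tn)
      have t3 := ((t2.const_sub 1).pow 2).mul_const (100 * y x)
      simpa [psi, chi] using t3
    refine t1.congr' ?_
    filter_upwards [tn.eventually_gt_atTop |x|] with n hn
    rw [Set.indicator_of_mem]
    rw [abs_lt] at hn
    exact ⟨hn.1, hn.2.le⟩

end VC

namespace VC

open MeasureTheory Real Filter Topology

lemma ibp {a b a1 b1 a2 b2 at' bt a1t b1t F H : ℝ → ℝ} {R : ℝ} (hR : 0 < R)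
    (ha : ∀ x, HasDerivAt a (a1 x) x) (hb : ∀ x, HasDerivAt b (b1 x) x)
    (ha1 : ∀ x, HasDerivAt a1 (a2 x) x) (hb1 : ∀ x, HasDerivAt b1 (b2 x) x)
    (hat : ∀ x, HasDerivAt at' (a1t x) x) (hbt : ∀ x, HasDerivAt bt (b1t x) x)
    (ca1t : Continuous a1t) (cb1t : Continuous b1t) (cF : Continuous F)
    (hH : ∀ x, HasDerivAt H (F x * (2 * (a x * a1 x + b x * b1 x))) x)
    (e1 : ∀ x, - bt x + a2 x = F x * a x) (e2 : ∀ x, at' x + b2 x = F x * b x) :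
    (∫ x in (-R)..R, psi R x * (bt x * a1 x + b x * a1t x - at' x * b1 x - a x * b1t x)) =
    -∫ x in (-R)..R, (psi1 R x * (2 * (a1 x ^ 2 + b1 x ^ 2) + (F x * (a x ^ 2 + b x ^ 2) - H x)) +
        psi2 R x * (a x * a1 x + b x * b1 x)) := by
  have cc : ∀ {g g' : ℝ → ℝ}, (∀ x, HasDerivAt g (g' x) x) → Continuous g := fun h =>
    continuous_iff_continuousAt.2 fun x => (h x).continuousAt
  have ca := cc ha
  have cb := cc hb
  have ca1 := cc ha1
  have cb1 := cc hb1
  have cat := cc hat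
  have cbt := cc hbt
  have cH := cc hH
  have p := psi_cont R
  have p1 := psi1_cont R
  have p2 := psi2_cont R
  have q : ∀ x, HasDerivAt
      (fun x => psi R x * (a1 x ^ 2 + b1 x ^ 2 - H x + (b x * at' x - a x * bt x)) +
        psi1 R x * (a x * a1 x + b x * b1 x))
      (psi R x * (bt x * a1 x + b x * a1t x - at' x * b1 x - a x * b1t x) +
      (psi1 R x * (2 * (a1 x ^ 2 + b1 x ^ 2) + (F x * (a x ^ 2 + b x ^ 2) - H x)) +
        psi2 R x * (a x * a1 x + b x * b1 x))) x := by
    intro x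
    have h1 := ((((ha1 x).fun_pow 2).fun_add ((hb1 x).fun_pow 2)).fun_sub (hH x)).fun_add
      (((hb x).fun_mul (hat x)).fun_sub ((ha x).fun_mul (hbt x)))
    have h2 := ((ha x).fun_mul (ha1 x)).fun_add ((hb x).fun_mul (hb1 x))
    have h3 := ((psi_deriv (R := R) x).fun_mul h1).fun_add ((psi1_deriv hR x).fun_mul h2)
    refine HasDerivAt.congr_deriv h3 ?_
    have e3 : a2 x = F x * a x + bt x := by linarith [e1 x]
    have e4 : b2 x = F x * b x - at' x := by linarith [e2 x]
    rw [e3, e4]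
    norm_num
    ring
  have i1 : IntervalIntegrable (fun x => psi R x * (bt x * a1 x + b x * a1t x - at' x * b1 x - a x * b1t x))
    volume (-R) R := Continuous.intervalIntegrable (by fun_prop) _ _
  have i2 : IntervalIntegrable (fun x => psi1 R x * (2 * (a1 x ^ 2 + b1 x ^ 2) + (F x * (a x ^ 2 + b x ^ 2) - H x)) +
        psi2 R x * (a x * a1 x + b x * b1 x)) volume (-R) R := Continuous.intervalIntegrable (by fun_prop) _ _
  have h := intervalIntegral.integral_eq_sub_of_hasDerivAt (a := -R) (b := R) (fun x _ => q x) (i1.add i2)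
  obtain ⟨r1, r2, r3, r4⟩ := psi_R hR
  rw [r1, r2, r3, r4, intervalIntegral.integral_add i1 i2] at h
  linarith

/-- the nonlinear density -/
noncomputable def nlin (f : ℝ → ℝ) (a b a1 b1 : ℝ → ℝ) (x : ℝ) : ℝ :=
  f (a x ^ 2 + b x ^ 2) * (a x ^ 2 + b x ^ 2) -
    ∫ z in (0 : ℝ)..x, f (a z ^ 2 + b z ^ 2) * (2 * (a z * a1 z + b z * b1 z))

lemma nlin_prop {r C₀ : ℝ} (hr : 1 < r) (hC : 0 ≤ C₀) {f : ℝ → ℝ}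
    (hf : ∀ s : ℝ, 0 ≤ s → |f s| ≤ C₀ * s ^ (r - 1)) {a b a1 b1 : ℝ → ℝ} (P : Prof a b a1 b1)
    (cf : Continuous (fun x => f (a x ^ 2 + b x ^ 2))) :
    Continuous (nlin f a b a1 b1) ∧
    (∀ x, |nlin f a b a1 b1 x| ≤ 2 * C₀ * (a x ^ 2 + b x ^ 2) ^ r) ∧
    (∀ x, HasDerivAt (fun x => ∫ z in (0 : ℝ)..x, f (a z ^ 2 + b z ^ 2) * (2 * (a z * a1 z + b z * b1 z)))
      (f (a x ^ 2 + b x ^ 2) * (2 * (a x * a1 x + b x * b1 x))) x) := by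
  have ca := P.ca
  have cb := P.cb
  have ca1 := P.ca1
  have cb1 := P.cb1
  have cg : Continuous (fun z => f (a z ^ 2 + b z ^ 2) * (2 * (a z * a1 z + b z * b1 z))) :=
    cf.mul (by fun_prop)
  have hH : ∀ x, HasDerivAt (fun x => ∫ z in (0 : ℝ)..x, f (a z ^ 2 + b z ^ 2) * (2 * (a z * a1 z + b z * b1 z)))
      (f (a x ^ 2 + b x ^ 2) * (2 * (a x * a1 x + b x * b1 x))) x := fun x =>
    intervalIntegral.integral_hasDerivAt_right (cg.intervalIntegrable _ _)
      cg.aestronglyMeasurable.stronglyMeasurableAtFilter cg.continuousAt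
  have cH := continuous_iff_continuousAt.2 fun x => (hH x).continuousAt
  refine ⟨?_, ?_, hH⟩
  · unfold nlin; exact (cf.mul (by fun_prop)).sub cH
  · intro x
    have hb := H_bound hr hC hf (fun x => P.w_deriv x) (by fun_prop) (by simp [P.a_zero, P.b_zero])
      (fun x => by positivity) cf x
    have hw : 0 ≤ a x ^ 2 + b x ^ 2 := by positivity
    have h1 : |f (a x ^ 2 + b x ^ 2) * (a x ^ 2 + b x ^ 2)| ≤ C₀ * (a x ^ 2 + b x ^ 2) ^ r := by
      rw [abs_mul, abs_of_nonneg hw, rpow_split hw hr, ← mul_assoc]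
      exact mul_le_mul_of_nonneg_right (hf _ hw) hw
    unfold nlin
    refine (abs_sub _ _).trans ?_
    linarith

lemma dyn {r C₀ E : ℝ} (hr : 1 < r) (hC : 0 ≤ C₀) {f : ℝ → ℝ}
    (hf : ∀ s : ℝ, 0 ≤ s → |f s| ≤ C₀ * s ^ (r - 1))
    {A B Ax Bx Axx Bxx At Bt Axt Bxt : ℝ → ℝ → ℝ}
    (cA : Continuous (Function.uncurry A)) (cB : Continuous (Function.uncurry B))
    (cAx : Continuous (Function.uncurry Ax)) (cBx : Continuous (Function.uncurry Bx))
    (cAt : Continuous (Function.uncurry At)) (cBt : Continuous (Function.uncurry Bt))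
    (cAxt : Continuous (Function.uncurry Axt)) (cBxt : Continuous (Function.uncurry Bxt))
    (P : ∀ t, Prof (A t) (B t) (Ax t) (Bx t))
    (cf : ∀ t, Continuous (fun x => f (A t x ^ 2 + B t x ^ 2)))
    (hE : ∀ t, (∫ x, (A t x ^ 2 + B t x ^ 2 + (Ax t x ^ 2 + Bx t x ^ 2))) ≤ E)
    (hAxx : ∀ t x, HasDerivAt (Ax t) (Axx t x) x) (hBxx : ∀ t x, HasDerivAt (Bx t) (Bxx t x) x)
    (hAt : ∀ t x, HasDerivAt (fun s => A s x) (At t x) t)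
    (hBt : ∀ t x, HasDerivAt (fun s => B s x) (Bt t x) t)
    (hAtx : ∀ t x, HasDerivAt (At t) (Axt t x) x)
    (hBtx : ∀ t x, HasDerivAt (Bt t) (Bxt t x) x)
    (hAxt : ∀ t x, HasDerivAt (fun s => Ax s x) (Axt t x) t)
    (hBxt : ∀ t x, HasDerivAt (fun s => Bx s x) (Bxt t x) t)
    (e1 : ∀ t x, - Bt t x + Axx t x = f (A t x ^ 2 + B t x ^ 2) * A t x)
    (e2 : ∀ t x, At t x + Bxx t x = f (A t x ^ 2 + B t x ^ 2) * B t x) (t : ℝ) :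
    HasDerivAt (fun s => ∫ x, 100 * y x * (B s x * Ax s x - A s x * Bx s x))
      (-∫ x, (W x * (2 * (Ax t x ^ 2 + Bx t x ^ 2) + nlin f (A t) (B t) (Ax t) (Bx t) x)
        + (-(2 * y x * W x / 100)) * (A t x * Ax t x + B t x * Bx t x))) t := by
  set G : ℝ → ℝ := fun t => -∫ x, (W x * (2 * (Ax t x ^ 2 + Bx t x ^ 2) + nlin f (A t) (B t) (Ax t) (Bx t) x)
        + (-(2 * y x * W x / 100)) * (A t x * Ax t x + B t x * Bx t x)) with hG
  set S : ℝ → ℝ → ℝ := fun t x => A t x ^ 2 + B t x ^ 2 + (Ax t x ^ 2 + Bx t x ^ 2) with hSdef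
  have E0 : 0 ≤ E := le_trans (integral_nonneg fun x => by positivity) (hE 0)
  set K : ℝ := 3 + 2 * C₀ * E ^ (r - 1) with hK
  have K0 : 0 ≤ K := by positivity
  have err : ∀ s, ∀ R, 1 ≤ R →
      |(∫ x in (-R)..R, (psi1 R x * (2 * (Ax s x ^ 2 + Bx s x ^ 2) + nlin f (A s) (B s) (Ax s) (Bx s) x) +
        psi2 R x * (A s x * Ax s x + B s x * Bx s x))) - -G s| ≤ 100000 / R * (K * E) := by
    intro s R hR
    have R0 : 0 < R := by linarith
    obtain ⟨n1, n2, n3⟩ := nlin_prop hr hC hf (P s) (cf s)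
    have ca := (P s).ca
    have cb := (P s).cb
    have ca1 := (P s).ca1
    have cb1 := (P s).cb1
    have h := cut_err (E1 := fun x => 2 * (Ax s x ^ 2 + Bx s x ^ 2) + nlin f (A s) (B s) (Ax s) (Bx s) x)
      (E2 := fun x => A s x * Ax s x + B s x * Bx s x) (S := fun x => K * S s x)
      (by fun_prop) (by fun_prop) ((P s).hS.const_mul K) ?_ hR
    · rw [integral_const_mul] at h
      simp only [hG, neg_neg]
      refine h.trans ?_
      have := hE s
      gcongr
    · intro x
      have hw : 0 ≤ A s x ^ 2 + B s x ^ 2 := by positivity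
      have hx : |nlin f (A s) (B s) (Ax s) (Bx s) x| ≤ 2 * C₀ * E ^ (r - 1) * S s x := by
        refine (n2 x).trans ?_
        rw [rpow_split hw hr, ← mul_assoc]
        have h1 : A s x ^ 2 + B s x ^ 2 ≤ E := ((P s).w_sup x).trans (hE s)
        have h2 : A s x ^ 2 + B s x ^ 2 ≤ S s x := by simp only [hSdef]; nlinarith [sq_nonneg (Ax s x), sq_nonneg (Bx s x)]
        have h3 : (A s x ^ 2 + B s x ^ 2) ^ (r - 1) ≤ E ^ (r - 1) := Real.rpow_le_rpow hw h1 (by linarith)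
        gcongr
      have h4 : |2 * (Ax s x ^ 2 + Bx s x ^ 2)| ≤ 2 * S s x := by
        rw [abs_of_nonneg (by positivity)]; simp only [hSdef]; linarith
      have h5 : |A s x * Ax s x + B s x * Bx s x| ≤ S s x := by
        simp only [hSdef]
        rw [abs_le]; constructor <;>
        nlinarith [sq_nonneg (A s x + Ax s x), sq_nonneg (A s x - Ax s x), sq_nonneg (B s x + Bx s x), sq_nonneg (B s x - Bx s x)]
      have h6 := abs_add_le (2 * (Ax s x ^ 2 + Bx s x ^ 2)) (nlin f (A s) (B s) (Ax s) (Bx s) x)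
      simp only [hK]
      linarith
  refine hasDerivAt_of_tendstoUniformly (l := atTop) (g' := G)
    (f := fun (n : ℕ) s => ∫ x in (-((n : ℝ) + 1))..((n : ℝ) + 1), psi ((n : ℝ) + 1) x * (B s x * Ax s x - A s x * Bx s x))
    (f' := fun (n : ℕ) s => -∫ x in (-((n : ℝ) + 1))..((n : ℝ) + 1),
      (psi1 ((n : ℝ) + 1) x * (2 * (Ax s x ^ 2 + Bx s x ^ 2) + nlin f (A s) (B s) (Ax s) (Bx s) x) +
        psi2 ((n : ℝ) + 1) x * (A s x * Ax s x + B s x * Bx s x))) ?_ ?_ ?_ t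
  · rw [Metric.tendstoUniformly_iff]
    intro δ hδ
    have tn : Tendsto (fun n : ℕ => (n : ℝ) + 1) atTop atTop :=
      tendsto_atTop_add_const_right _ _ tendsto_natCast_atTop_atTop
    have t0 : Tendsto (fun n : ℕ => 100000 / ((n : ℝ) + 1) * (K * E)) atTop (𝓝 0) := by
      simpa using (tendsto_const_nhds.div_atTop tn).mul_const (K * E)
    filter_upwards [t0.eventually_lt_const hδ] with n hn s
    refine lt_of_le_of_lt ?_ hn
    have := err s ((n : ℝ) + 1) (by have : (0 : ℝ) ≤ n := n.cast_nonneg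
                                    linarith)
    rw [Real.dist_eq]
    rw [sub_neg_eq_add] at this ⊢
    rw [add_comm (G s)]
    exact this
  · refine Eventually.of_forall fun n s => ?_
    have hn : (0 : ℝ) < (n : ℝ) + 1 := by positivity
    obtain ⟨n1, n2, n3⟩ := nlin_prop hr hC hf (P s) (cf s)
    have cxt : ∀ {g : ℝ → ℝ → ℝ}, Continuous (Function.uncurry g) → ∀ t, Continuous (g t) :=
      fun h t => h.comp (by fun_prop : Continuous fun x : ℝ => (t, x))
    have hi := ibp hn (P s).ha (P s).hb (hAxx s) (hBxx s) (hAtx s) (hBtx s) (cxt cAxt s) (cxt cBxt s)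
      (cf s) n3 (e1 s) (e2 s)
    have hd := diff_int
      (M := fun s x => psi ((n : ℝ) + 1) x * (B s x * Ax s x - A s x * Bx s x))
      (Mt := fun s x => psi ((n : ℝ) + 1) x *
        (Bt s x * Ax s x + B s x * Axt s x - At s x * Bx s x - A s x * Bxt s x)) ?_ ?_ ?_
      (-((n : ℝ) + 1)) ((n : ℝ) + 1) s
    · exact hd.congr_deriv hi
    · exact ((psi_cont _).comp continuous_snd).mul ((cB.mul cAx).sub (cA.mul cBx))
    · exact ((psi_cont _).comp continuous_snd).mul
        ((((cBt.mul cAx).add (cB.mul cAxt)).sub (cAt.mul cBx)).sub (cA.mul cBxt))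
    · intro s x
      have h := ((((hBt s x).fun_mul (hAxt s x)).fun_sub ((hAt s x).fun_mul (hBxt s x)))).const_mul (psi ((n : ℝ) + 1) x)
      refine h.congr_deriv ?_
      ring
  · intro s
    have ca := (P s).ca
    have cb := (P s).cb
    have ca1 := (P s).ca1
    have cb1 := (P s).cb1
    have cM : Continuous (fun x => B s x * Ax s x - A s x * Bx s x) := by fun_prop
    refine cut_tendsto cM ((P s).integ cM 1 fun x => ?_)
    rw [abs_le]; constructor <;>
    nlinarith [sq_nonneg (B s x + Ax s x), sq_nonneg (B s x - Ax s x), sq_nonneg (A s x + Bx s x), sq_nonneg (A s x - Bx s x)]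

end VC

open MeasureTheory Real

/-- Lemma 2.4: virial coercivity for small odd solutions of NLS (λ = 100,
φ(x) = 100·tanh(x/100)). -/
theorem virial_coercivity_NLS
    (p C₀ : ℝ) (hp1 : 1 < p) (hp5 : p < 5)
    (f : ℝ → ℝ) (hf : ∀ s : ℝ, 0 ≤ s → |f s| ≤ C₀ * s ^ ((p - 1) / 2)) :
    ∃ ε > 0, ∃ C > 0, ∀ u : ℝ → ℝ → ℂ,
      ContDiff ℝ (⊤ : ℕ∞) (Function.uncurry u) →
      (∀ t x : ℝ, Complex.I * deriv (fun s => u s x) t + deriv (deriv (u t)) x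
          = (f (‖u t x‖ ^ 2) : ℂ) * u t x) →
      (∀ t x : ℝ, u t (-x) = - u t x) →
      (∀ t : ℝ, ∃ g : SchwartzMap ℝ ℂ, ∀ x : ℝ, u t x = g x) →
      (∀ t : ℝ, (∫ x : ℝ, ‖u t x‖ ^ 2) + (∫ x : ℝ, ‖deriv (u t) x‖ ^ 2) ≤ ε ^ 2) →
      ∀ t : ℝ, ∃ D : ℝ,
        HasDerivAt (fun s : ℝ =>
            (∫ x : ℝ, ((100 * Real.tanh (x / 100) : ℝ) : ℂ) * u s x
              * (starRingEnd ℂ) (deriv (u s) x)).im) D t ∧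
        C * (∫ x : ℝ, (1 / Real.cosh x) * (‖deriv (u t) x‖ ^ 2 + ‖u t x‖ ^ 2)) ≤ -D := by
  have hC : 0 ≤ C₀ := by
    have := hf 1 (by norm_num)
    rw [Real.one_rpow, mul_one] at this
    exact (abs_nonneg _).trans this
  obtain ⟨r, hr⟩ : ∃ r : ℝ, r = (p + 1) / 2 := ⟨_, rfl⟩
  have hr1 : 1 < r := by rw [hr]; linarith
  have hrp : (p - 1) / 2 = r - 1 := by rw [hr]; ring
  rw [hrp] at hf
  obtain ⟨κ, hκ⟩ : ∃ κ : ℝ, κ = min 1 (2 * r - 2) := ⟨_, rfl⟩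
  have κ0 : 0 < κ := by rw [hκ]; exact lt_min one_pos (by linarith)
  have κ1 : κ ≤ 1 := by rw [hκ]; exact min_le_left _ _
  have κ2 : κ ≤ 2 * r - 2 := by rw [hκ]; exact min_le_right _ _
  -- smallness
  obtain ⟨ε, ε0, hε⟩ : ∃ ε : ℝ, 0 < ε ∧
      2 * C₀ * (4 * r ^ 2 * 10000 / κ ^ 2) * (ε ^ 2) ^ (r - 1) ≤ 1 / 8 := by
    have c : Continuous (fun ε : ℝ => 2 * C₀ * (4 * r ^ 2 * 10000 / κ ^ 2) * (ε ^ 2) ^ (r - 1)) :=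
      continuous_const.mul ((continuous_id.pow 2).rpow_const fun x => Or.inr (by linarith))
    have t := c.tendsto 0
    simp only [ne_eq, OfNat.ofNat_ne_zero, not_false_eq_true, zero_pow] at t
    rw [Real.zero_rpow (by linarith), mul_zero] at t
    have h1 := (t.eventually_lt_const (by norm_num : (0 : ℝ) < 1 / 8)).filter_mono
      (nhdsWithin_le_nhds (s := Set.Ioi (0 : ℝ)))
    obtain ⟨ε, h2, h3⟩ := (h1.and self_mem_nhdsWithin).exists
    exact ⟨ε, h3, h2.le⟩
  refine ⟨ε, ε0, 1 / 100000, by norm_num, ?_⟩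
  intro u hu pde odd sch small t
  obtain ⟨A, hA⟩ : ∃ A : ℝ → ℝ → ℝ, A = fun t x => (u t x).re := ⟨_, rfl⟩
  obtain ⟨B, hB⟩ : ∃ B : ℝ → ℝ → ℝ, B = fun t x => (u t x).im := ⟨_, rfl⟩
  have sA : ContDiff ℝ (⊤ : ℕ∞) (Function.uncurry A) := by
    rw [hA]; exact Complex.reCLM.contDiff.comp hu
  have sB : ContDiff ℝ (⊤ : ℕ∞) (Function.uncurry B) := by
    rw [hB]; exact Complex.imCLM.contDiff.comp hu
  obtain ⟨Ax, At, Axt, sAx, sAt, cAxt, hAx, hAt, hAtx, hAxt⟩ := VC.partials sA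
  obtain ⟨Bx, Bt, Bxt, sBx, sBt, cBxt, hBx, hBt, hBtx, hBxt⟩ := VC.partials sB
  obtain ⟨Axx, -, -, sAxx, -, -, hAxx, -⟩ := VC.partials sAx
  obtain ⟨Bxx, -, -, sBxx, -, -, hBxx, -⟩ := VC.partials sBx
  have uAB : ∀ t x, u t x = (A t x : ℂ) + (B t x : ℂ) * Complex.I := by
    intro t x; rw [hA, hB]; exact (Complex.re_add_im _).symm
  have dux : ∀ t x, HasDerivAt (u t) ((Ax t x : ℂ) + (Bx t x : ℂ) * Complex.I) x := by
    intro t x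
    have h := ((hAx t x).ofReal_comp).fun_add (((hBx t x).ofReal_comp).mul_const Complex.I)
    exact h.congr_of_eventuallyEq (Filter.Eventually.of_forall fun z => uAB t z)
  have dut : ∀ t x, HasDerivAt (fun s => u s x) ((At t x : ℂ) + (Bt t x : ℂ) * Complex.I) t := by
    intro t x
    have h := ((hAt t x).ofReal_comp).fun_add (((hBt t x).ofReal_comp).mul_const Complex.I)
    exact h.congr_of_eventuallyEq (Filter.Eventually.of_forall fun z => uAB z x)
  have dx : ∀ t, deriv (u t) = fun x => (Ax t x : ℂ) + (Bx t x : ℂ) * Complex.I := fun t =>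
    funext fun x => (dux t x).deriv
  have duxx : ∀ t x, HasDerivAt (deriv (u t)) ((Axx t x : ℂ) + (Bxx t x : ℂ) * Complex.I) x := by
    intro t x
    rw [dx t]
    exact ((hAxx t x).ofReal_comp).fun_add (((hBxx t x).ofReal_comp).mul_const Complex.I)
  have nrm : ∀ a b : ℝ, ‖(a : ℂ) + (b : ℂ) * Complex.I‖ ^ 2 = a ^ 2 + b ^ 2 := by
    intro a b
    rw [Complex.sq_norm, Complex.normSq_add_mul_I]
  have nu : ∀ t x, ‖u t x‖ ^ 2 = A t x ^ 2 + B t x ^ 2 := by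
    intro t x; rw [uAB, nrm]
  have nux : ∀ t x, ‖deriv (u t) x‖ ^ 2 = Ax t x ^ 2 + Bx t x ^ 2 := by
    intro t x; rw [dx, nrm]
  have e : ∀ t x, (- Bt t x + Axx t x = f (A t x ^ 2 + B t x ^ 2) * A t x) ∧
      (At t x + Bxx t x = f (A t x ^ 2 + B t x ^ 2) * B t x) := by
    intro t x
    have h := pde t x
    rw [(dut t x).deriv, (duxx t x).deriv, nu, uAB] at h
    have h1 := congrArg Complex.re h
    have h2 := congrArg Complex.im h
    simp at h1 h2
    exact ⟨h1, h2⟩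
  have cxt : ∀ {g : ℝ → ℝ → ℝ}, ContDiff ℝ (⊤ : ℕ∞) (Function.uncurry g) → ∀ t, Continuous (g t) :=
    fun h t => h.continuous.comp (by fun_prop : Continuous fun x : ℝ => (t, x))
  have sq : ∀ g : SchwartzMap ℝ ℂ, Integrable (fun x => ‖g x‖ ^ 2) := fun g =>
    (memLp_two_iff_integrable_sq_norm g.continuous.aestronglyMeasurable).1 (g.memLp 2)
  have iu : ∀ t, Integrable (fun x => A t x ^ 2 + B t x ^ 2) := by
    intro t
    obtain ⟨g, hg⟩ := sch t
    refine (sq g).congr (Filter.Eventually.of_forall fun x => ?_)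
    show ‖g x‖ ^ 2 = _
    rw [← hg, nu]
  have iux : ∀ t, Integrable (fun x => Ax t x ^ 2 + Bx t x ^ 2) := by
    intro t
    obtain ⟨g, hg⟩ := sch t
    have hg' : u t = g := funext hg
    refine (sq (SchwartzMap.derivCLM ℝ ℂ g)).congr (Filter.Eventually.of_forall fun x => ?_)
    show ‖SchwartzMap.derivCLM ℝ ℂ g x‖ ^ 2 = _
    rw [SchwartzMap.derivCLM_apply, ← hg', nux]
  have P : ∀ t, VC.Prof (A t) (B t) (Ax t) (Bx t) := fun t =>
    { ha := hAx t
      hb := hBx t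
      ca1 := cxt sAx t
      cb1 := cxt sBx t
      hS := (iu t).add (iux t)
      oa := fun x => by rw [hA]; simp [odd]
      ob := fun x => by rw [hB]; simp [odd] }
  have cf : ∀ t, Continuous (fun x => f (A t x ^ 2 + B t x ^ 2)) := by
    intro t
    refine VC.cont_fw hr1 hf (cxt sA t) (cxt sB t) (na := fun x => - Bt t x + Axx t x)
      (nb := fun x => At t x + Bxx t x) ((cxt sBt t).neg.add (cxt sAxx t))
      ((cxt sAt t).add (cxt sBxx t)) (fun x => (e t x).1.symm) (fun x => (e t x).2.symm)
  have hE : ∀ t, (∫ x, (A t x ^ 2 + B t x ^ 2 + (Ax t x ^ 2 + Bx t x ^ 2))) ≤ ε ^ 2 := by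
    intro t
    have h := small t
    simp only [nu, nux] at h
    rw [integral_add (iu t) (iux t)]
    exact h
  have hd := VC.dyn hr1 hC hf sA.continuous sB.continuous sAx.continuous sBx.continuous sAt.continuous
    sBt.continuous cAxt cBxt P cf hE hAxx hBxx hAt hBt hAtx hBtx hAxt hBxt
    (fun t x => (e t x).1) (fun t x => (e t x).2) t
  have him : (fun s : ℝ =>
            (∫ x : ℝ, ((100 * Real.tanh (x / 100) : ℝ) : ℂ) * u s x
              * (starRingEnd ℂ) (deriv (u s) x)).im) =
      fun s => ∫ x, 100 * VC.y x * (B s x * Ax s x - A s x * Bx s x) := by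
    funext s
    have ca := cxt sA s
    have cb := cxt sB s
    have ca1 := cxt sAx s
    have cb1 := cxt sBx s
    have cy := VC.y_cont
    have ev : ∀ x, ((100 * Real.tanh (x / 100) : ℝ) : ℂ) * u s x * (starRingEnd ℂ) (deriv (u s) x) =
        ((100 * VC.y x * (A s x * Ax s x + B s x * Bx s x) : ℝ) : ℂ) +
        ((100 * VC.y x * (B s x * Ax s x - A s x * Bx s x) : ℝ) : ℂ) * Complex.I := by
      intro x
      rw [uAB, dx]
      apply Complex.ext
      · simp [VC.y]
        ring
      · simp [VC.y]
        ring
    have c1 : Continuous (fun x => 100 * VC.y x * (A s x * Ax s x + B s x * Bx s x)) := by fun_prop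
    have c2 : Continuous (fun x => 100 * VC.y x * (B s x * Ax s x - A s x * Bx s x)) := by fun_prop
    have i1 : Integrable (fun x => 100 * VC.y x * (A s x * Ax s x + B s x * Bx s x)) := by
      refine (P s).integ c1 100 fun x => ?_
      have hy := VC.y_abs x
      have h5 : |A s x * Ax s x + B s x * Bx s x| ≤ A s x ^ 2 + B s x ^ 2 + (Ax s x ^ 2 + Bx s x ^ 2) := by
        rw [abs_le]; constructor <;>
        nlinarith [sq_nonneg (A s x + Ax s x), sq_nonneg (A s x - Ax s x), sq_nonneg (B s x + Bx s x), sq_nonneg (B s x - Bx s x)]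
      rw [abs_mul, abs_mul, abs_of_pos (by norm_num : (0 : ℝ) < 100)]
      nlinarith [abs_nonneg (VC.y x), abs_nonneg (A s x * Ax s x + B s x * Bx s x)]
    have i2 : Integrable (fun x => 100 * VC.y x * (B s x * Ax s x - A s x * Bx s x)) := by
      refine (P s).integ c2 100 fun x => ?_
      have hy := VC.y_abs x
      have h5 : |B s x * Ax s x - A s x * Bx s x| ≤ A s x ^ 2 + B s x ^ 2 + (Ax s x ^ 2 + Bx s x ^ 2) := by
        rw [abs_le]; constructor <;>
        nlinarith [sq_nonneg (B s x + Ax s x), sq_nonneg (B s x - Ax s x), sq_nonneg (A s x + Bx s x), sq_nonneg (A s x - Bx s x)]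
      rw [abs_mul, abs_mul, abs_of_pos (by norm_num : (0 : ℝ) < 100)]
      nlinarith [abs_nonneg (VC.y x), abs_nonneg (B s x * Ax s x - A s x * Bx s x)]
    simp only [ev]
    have q1 := integral_complex_ofReal (μ := volume)
      (f := fun x => 100 * VC.y x * (A s x * Ax s x + B s x * Bx s x))
    have q2 := integral_complex_ofReal (μ := volume)
      (f := fun x => 100 * VC.y x * (B s x * Ax s x - A s x * Bx s x))
    have q3 := integral_add (i1.ofReal (𝕜 := ℂ)) ((i2.ofReal (𝕜 := ℂ)).mul_const Complex.I)
    rw [integral_mul_const] at q3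
    refine (congrArg Complex.im (q3.trans (congrArg₂ (· + · * Complex.I) q1 q2))).trans ?_
    simp only [Complex.add_im, Complex.ofReal_im, Complex.im_ofReal_mul, Complex.I_im, zero_add, mul_one]
  rw [him]
  refine ⟨_, hd, ?_⟩
  rw [neg_neg]
  simp only [nu, nux]
  obtain ⟨n1, n2, -⟩ := VC.nlin_prop hr1 hC hf (P t) (cf t)
  exact (P t).coer hr1 κ0 κ1 κ2 hC (fun x => ((P t).w_sup x).trans (hE t)) n1 n2 hε
end

section
/- Let 1 < p < 5 and f : ℝ → ℝ with |f(s)| ≤ C₀·s^((p-1)/2) for s ≥ 0. There exist ε > 0 and C > 0 such that: if u is a smooth solution of i∂ₜu + ∂ₓₓu = f(|u|²)u, odd in x, with u(t,·) in the Schwartz class in x for each t and sup_{t∈ℝ}(‖u(t,·)‖_{L²(ℝ)}² + ‖∂ₓu(t,·)‖_{L²(ℝ)}²) ≤ ε², then ∫₀^∞ ∫_ℝ sech(x)(|∂ₓu(t,x)|² + |u(t,x)|²) dx dt ≤ C·ε². -/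
open MeasureTheory Real

lemma f_contOn (f h : ℝ → ℝ) (hh : Continuous h) (hg : Continuous (fun x => f (h x))) (x : ℝ) :
    ContinuousOn f (h '' Set.uIcc 0 x) := by
  set K := Set.uIcc (0:ℝ) x
  have hK : IsCompact K := isCompact_uIcc
  have : CompactSpace K := isCompact_iff_compactSpace.mp hK
  let φ : K → (h '' K) := fun y => ⟨h y, y, y.2, rfl⟩
  have hφ : Continuous φ := by
    apply Continuous.subtype_mk
    exact hh.comp continuous_subtype_val
  have hs : Function.Surjective φ := by
    rintro ⟨_, y, hy, rfl⟩
    exact ⟨⟨y, hy⟩, rfl⟩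
  have hq : Topology.IsQuotientMap φ := .of_surjective_continuous hs hφ
  rw [continuousOn_iff_continuous_domRestrict, hq.continuous_iff]
  exact hg.comp continuous_subtype_val

/-- continuity of `f ∘ h`. -/
lemma g_cont (C₀ r : ℝ) (hr : 1 < r) (f h k : ℝ → ℝ) (hh : Continuous h) (hk : Continuous k)
    (hpos : ∀ x, 0 ≤ h x) (hf : ∀ s : ℝ, 0 ≤ s → |f s| ≤ C₀ * s ^ (r - 1))
    (hfk : ∀ x, f (h x) * h x = k x) : Continuous (fun x => f (h x)) := by
  rw [continuous_iff_continuousAt]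
  intro x
  by_cases hx : h x = 0
  · have h0 : f (h x) = 0 := by
      have := hf (h x) (hpos x)
      rw [hx, Real.zero_rpow (by linarith), mul_zero] at this
      rw [hx]; exact abs_nonpos_iff.mp this
    unfold ContinuousAt
    simp only [h0]
    apply squeeze_zero_norm (fun y => hf (h y) (hpos y))
    have : ContinuousAt (fun y => C₀ * h y ^ (r-1)) x := by
      apply ContinuousAt.mul continuousAt_const
      exact hh.continuousAt.rpow_const (Or.inr (by linarith))
    unfold ContinuousAt at this
    beta_reduce at this
    rwa [hx, Real.zero_rpow (by linarith), mul_zero] at this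
  · have : ContinuousAt (fun y => k y / h y) x := hk.continuousAt.div hh.continuousAt hx
    apply this.congr
    filter_upwards [hh.continuousAt.eventually_ne hx] with y hy
    rw [← hfk y]; field_simp

lemma G_bound (C₀ r : ℝ) (hr : 1 < r) (hC : 0 ≤ C₀) (f h h' k : ℝ → ℝ)
    (hd : ∀ x, HasDerivAt h (h' x) x) (hk : Continuous k) (hh' : Continuous h')
    (hpos : ∀ x, 0 ≤ h x) (hf : ∀ s : ℝ, 0 ≤ s → |f s| ≤ C₀ * s ^ (r - 1))
    (hfk : ∀ x, f (h x) * h x = k x) (h0 : h 0 = 0) (x : ℝ) :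
    |∫ y in (0:ℝ)..x, f (h y) * h' y| ≤ C₀ * h x ^ r := by
  have hh : Continuous h := continuous_iff_continuousAt.2 fun x => (hd x).continuousAt
  have hg := g_cont C₀ r hr f h k hh hk hpos hf hfk
  have := f_contOn f h hh hg x
  have e := intervalIntegral.integral_comp_mul_deriv'' (a := 0) (b := x) (f := h) (f' := h') (g := f)
    hh.continuousOn (fun y _ => (hd y).hasDerivWithinAt) hh'.continuousOn this
  simp only [Function.comp] at e
  rw [e, h0]
  have hb : ∀ y ∈ Set.uIoc 0 (h x), ‖f y‖ ≤ C₀ * h x ^ (r-1) := by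
    intro y hy
    rw [Set.uIoc_of_le (hpos x)] at hy
    refine (hf y hy.1.le).trans ?_
    gcongr
    · exact hy.1.le
    · exact hy.2
  have := intervalIntegral.norm_integral_le_of_norm_le_const hb
  rw [sub_zero, abs_of_nonneg (hpos x)] at this
  refine this.trans (le_of_eq ?_)
  rw [mul_assoc]
  congr 1
  conv_lhs => rw [← Real.rpow_one (h x), ← Real.rpow_mul (hpos x)]
  rw [← Real.rpow_add_of_nonneg (hpos x) (by linarith) (by norm_num)]
  congr 1; ring

lemma core_alg (a b a1 b1 y r C₀ κ P N : ℝ) (hr : 1 < r) (hC : 0 ≤ C₀) 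
    (hy0 : 0 ≤ y) (hy1 : y ≤ 1) (hP0 : 0 ≤ P)
    (hN : |N| ≤ 2 * C₀ * ((a^2+b^2) * P)) (hκ : κ * (r-1) = 16 * C₀) (hκ0 : 0 ≤ κ)
    (hsmall : 64 * C₀ * r^2 * P ≤ (r-1)^2) :
    1/50 * y^2 * ((a1^2+b1^2) + (a^2+b^2)) ≤
      (y+y^2) * (2 * (a1^2+b1^2) + N) - 1/2 * (y/4+y^2) * (a^2+b^2)
      - ((y/2+y^2) * (2 * (a*a1+b*b1)) - (y/4+y^2) * (a^2+b^2))
      + κ * (y * (2 * (a*a1+b*b1)) * r * P - y/2 * ((a^2+b^2) * P)) := by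
  obtain ⟨A, hA⟩ : ∃ A, A = (a1 - a/4)^2 + (b1-b/4)^2 := ⟨_, rfl⟩
  obtain ⟨B, hB⟩ : ∃ B, B = (a1 - a/2)^2 + (b1-b/2)^2 := ⟨_, rfl⟩
  have hA0 : 0 ≤ A := by rw [hA]; positivity
  have hB0 : 0 ≤ B := by rw [hB]; positivity
  have hAB : 1/50 * ((a1^2+b1^2) + (a^2+b^2)) ≤ A + B := by
    rw [hA, hB]; linarith [sq_nonneg a, sq_nonneg b, sq_nonneg (1.98*a1 - 0.75*a), sq_nonneg (1.98*b1 - 0.75*b)]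
  have hN' := (abs_le.mp hN).1
  have hr1 : 0 < r - 1 := by linarith
  have k1 : (r-1) * ((r-1) * (a^2+b^2) / 4) - 4 * r^2 * A ≤
      (r-1) * (2 * (a*a1+b*b1) * r - (a^2+b^2)/2) := by
    have e : (r-1) * (2 * (a*a1+b*b1) * r - (a^2+b^2)/2) - ((r-1) * ((r-1) * (a^2+b^2) / 4) - 4 * r^2 * A)
      = (((r-1)/2 * a + 2 * r * (a1 - a/4))^2 + ((r-1)/2 * b + 2 * r * (b1 - b/4))^2) := by
      rw [hA]; ring
    have : 0 ≤ (((r-1)/2 * a + 2 * r * (a1 - a/4))^2 + ((r-1)/2 * b + 2 * r * (b1 - b/4))^2) := by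
      positivity
    linarith
  have k2 : 4 * C₀ * ((a^2+b^2) * P) - A ≤ κ * P * (2 * (a*a1+b*b1) * r - (a^2+b^2)/2) := by
    have h1 := mul_le_mul_of_nonneg_left k1 (mul_nonneg (mul_nonneg hκ0 hP0) hr1.le)
    have h2 : 64 * C₀ * r^2 * P * A ≤ (r-1)^2 * A := mul_le_mul_of_nonneg_right hsmall hA0
    have h3 : (r-1)^2 * (4 * C₀ * ((a^2+b^2) * P) - A) ≤
       (r-1)^2 * (κ * P * (2 * (a*a1+b*b1) * r - (a^2+b^2)/2)) := by
      have e1 : κ * P * (r-1) * ((r-1) * ((r-1) * (a^2+b^2) / 4) - 4 * r^2 * A)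
        = (κ * (r-1)) * P * ((r-1) * ((r-1) * (a^2+b^2) / 4) - 4 * r^2 * A) := by ring
      rw [e1, hκ] at h1
      linarith
    exact le_of_mul_le_mul_left h3 (by positivity)
  have k3 := mul_le_mul_of_nonneg_left k2 hy0
  have k4 : -(4 * C₀ * y * ((a^2+b^2) * P)) ≤ (y+y^2) * N := by
    have h0 : 0 ≤ C₀ * ((a^2+b^2) * P) := by positivity
    have h1 := mul_le_mul_of_nonneg_left hN' (show 0 ≤ y+y^2 by positivity)
    have h2 : y + y^2 ≤ 2*y := by nlinarith
    linarith [mul_le_mul_of_nonneg_right h2 h0]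
  have k5 : y^2 * (1/50 * ((a1^2+b1^2) + (a^2+b^2))) ≤ y^2*(A+B) :=
    mul_le_mul_of_nonneg_left hAB (sq_nonneg y)
  have k6 : y^2 * A ≤ y * A := mul_le_mul_of_nonneg_right (by nlinarith) hA0
  have k7 : 0 ≤ y^2 * B := by positivity
  have e : (y+y^2) * (2 * (a1^2+b1^2) + N) - 1/2 * (y/4+y^2) * (a^2+b^2)
      - ((y/2+y^2) * (2 * (a*a1+b*b1)) - (y/4+y^2) * (a^2+b^2)) = 2*(y * A)+2*(y^2*B) + (y+y^2)*N := by
    rw [hA, hB]; ring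
  rw [e]
  linarith

lemma point_alg (a b a1 b1 y s q r C₀ κ P N : ℝ) (hr : 1 < r) (hC : 0 ≤ C₀) 
    (hy0 : 0 ≤ y) (hy1 : y ≤ 1) (hP0 : 0 ≤ P) (hP1 : P ≤ 1) (hs0 : 0 ≤ s) (hs1 : s ≤ 1)
    (hq0 : 0 ≤ q) (hq1 : q ≤ 1)
    (hN : |N| ≤ 2 * C₀ * ((a^2+b^2) * P)) (hκ : κ * (r-1) = 16 * C₀) (hκ0 : 0 ≤ κ)
    (hsmall : 64 * C₀ * r^2 * P ≤ (r-1)^2) :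
    1/50 * (s^4 * y^2 * ((a1^2+b1^2) + (a^2+b^2)))
        - (105 + 24 * C₀ + 4 * κ) * q * ((a1^2+b1^2) + (a^2+b^2)) ≤
      (s^4*(y+y^2) - 4*s^3*q*(3-2*y-y^2)) * (2 * (a1^2+b1^2) + N)
      - 1/2 * (s^4*(y/4+y^2) + 3*(-4*s^3*q)*(-(y/2+y^2)) + 3*(12*s^2*q^2)*(y+y^2)
          - 24*s*q^3*(3-2*y-y^2)) * (a^2+b^2)
      - (-4*s^3*q*((y/2+y^2)*(a^2+b^2)) 
          + s^4 * ((y/2+y^2) * (2 * (a*a1+b*b1)) - (y/4+y^2) * (a^2+b^2)))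
      + κ * (-4*s^3*q*(y*((a^2+b^2)*P))
          + s^4*(y * (2 * (a*a1+b*b1)) * r * P - y/2 * ((a^2+b^2) * P))) := by
  have core := mul_le_mul_of_nonneg_left
    (core_alg a b a1 b1 y r C₀ κ P N hr hC hy0 hy1 hP0 hN hκ hκ0 hsmall) (show 0 ≤ s^4 by positivity)
  obtain ⟨h, hh⟩ : ∃ h, h = a^2+b^2 := ⟨_, rfl⟩
  obtain ⟨n, hn⟩ : ∃ n, n = a1^2+b1^2 := ⟨_, rfl⟩
  obtain ⟨m, hm⟩ : ∃ m, m = a*a1+b*b1 := ⟨_, rfl⟩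
  have h0 : 0 ≤ h := by rw [hh]; positivity
  have n0 : 0 ≤ n := by rw [hn]; positivity
  rw [← hh, ← hn, ← hm] at core ⊢
  rw [← hh] at hN
  have hs3 : s^3 ≤ 1 := pow_le_one₀ hs0 hs1
  have hs2 : s^2 ≤ 1 := pow_le_one₀ hs0 hs1
  have hs3' : 0 ≤ s^3 := by positivity
  have hy2 : y^2 ≤ 1 := pow_le_one₀ hy0 hy1
  have hhP : h * P ≤ h := mul_le_of_le_one_right h0 hP1
  have hhP0 : 0 ≤ h * P := by positivity
  have hNh : |N| ≤ 2 * C₀ * h := hN.trans (by gcongr)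
  have hpsi0 : 0 ≤ 3 - 2*y - y^2 := by nlinarith
  have hpsi3 : 3 - 2*y - y^2 ≤ 3 := by nlinarith
  have e1 : 4*s^3*q*(3-2*y-y^2) * (2*n+N) ≤ q * (24 * n + 24 * C₀ * h) := by
    have i1 : 2*n+N ≤ 2*n + 2*C₀*h := by linarith [le_abs_self N]
    have i2 : 0 ≤ 2*n + 2*C₀*h := by positivity
    have i3 : s^3 * (3-2*y-y^2) ≤ 1 * 3 := mul_le_mul hs3 hpsi3 hpsi0 (by norm_num)
    have i4 : 0 ≤ s^3 * (3-2*y-y^2) := by positivity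
    calc 4*s^3*q*(3-2*y-y^2) * (2*n+N) = 4*q*((s^3*(3-2*y-y^2)) * (2*n+N)) := by ring
      _ ≤ 4*q*((s^3*(3-2*y-y^2)) * (2*n + 2*C₀*h)) := by gcongr
      _ ≤ 4*q*((1*3) * (2*n + 2*C₀*h)) := by gcongr
      _ = _ := by ring
  have e2 : 1/2 * (3*(-4*s^3*q)*(-(y/2+y^2)) + 3*(12*s^2*q^2)*(y+y^2)
          - 24*s*q^3*(3-2*y-y^2)) * h ≤ 81 * q * h := by
    have j1 : s^3*(y/2+y^2) ≤ 1 * (3/2) := mul_le_mul hs3 (by linarith) (by positivity) (by norm_num)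
    have j2 : s^2*(y+y^2) ≤ 1 * 2 := mul_le_mul hs2 (by linarith) (by positivity) (by norm_num)
    have j3 : q^2 ≤ q := by nlinarith
    have j4 : 0 ≤ s*q^3*(3-2*y-y^2) := by positivity
    have j5 : q^2 * (s^2*(y+y^2)) ≤ q * (1*2) := mul_le_mul j3 j2 (by positivity) hq0
    have j6 : q * (s^3*(y/2+y^2)) ≤ q * (1*(3/2)) := mul_le_mul_of_nonneg_left j1 hq0
    apply mul_le_mul_of_nonneg_right _ h0
    linarith
  have e3 : 0 ≤ 4*s^3*q*((y/2+y^2)*h) := by positivity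
  have e4 : κ*(4*s^3*q*(y*(h*P))) ≤ 4*κ*q*h := by
    have l1 : s^3 * (y*(h*P)) ≤ 1 * (1 * h) := 
      mul_le_mul hs3 (mul_le_mul hy1 hhP hhP0 (by norm_num)) (by positivity) (by norm_num)
    have := mul_le_mul_of_nonneg_left l1 (show 0 ≤ κ * q by positivity)
    linarith
  have e5 : 0 ≤ q * n := by positivity
  have e6 : 0 ≤ q * h := by positivity
  have e7 : 0 ≤ C₀ * (q * n) := by positivity
  have e8 : 0 ≤ κ * (q * n) := by positivity
  linarith

lemma fixed_time (r C₀ κ R q : ℝ) (hr : 1 < r) (hC : 0 ≤ C₀) (hκ : κ * (r-1) = 16 * C₀) (hκ0 : 0 ≤ κ)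
    (hR : 1 ≤ R) (hq : q = R⁻¹)
    (f : ℝ → ℝ) (hf : ∀ s : ℝ, 0 ≤ s → |f s| ≤ C₀ * s ^ (r - 1))
    (a a1 a2 b b1 b2 c c1 d d1 : ℝ → ℝ)
    (da : ∀ x, HasDerivAt a (a1 x) x) (da1 : ∀ x, HasDerivAt a1 (a2 x) x)
    (db : ∀ x, HasDerivAt b (b1 x) x) (db1 : ∀ x, HasDerivAt b1 (b2 x) x)
    (dc : ∀ x, HasDerivAt c (c1 x) x) (dd : ∀ x, HasDerivAt d (d1 x) x)
    (ca2 : Continuous a2) (cb2 : Continuous b2) (cc1 : Continuous c1) (cd1 : Continuous d1)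
    (eqa : ∀ x, - d x + a2 x = f (a x ^ 2 + b x ^ 2) * a x)
    (eqb : ∀ x, c x + b2 x = f (a x ^ 2 + b x ^ 2) * b x)
    (a0 : a 0 = 0) (b0 : b 0 = 0)
    (hP : ∀ x ∈ Set.Icc 0 R, (a x ^ 2 + b x ^ 2) ^ (r-1) ≤ 1 ∧
      64 * C₀ * r^2 * (a x ^ 2 + b x ^ 2) ^ (r-1) ≤ (r-1)^2) :
    1/50 * (∫ x in (0:ℝ)..R, (1 - x * q)^4 * exp (-x/2)^2 * ((a1 x^2+b1 x^2) + (a x^2+b x^2)))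
      - (105 + 24 * C₀ + 4 * κ) * q * (∫ x in (0:ℝ)..R, ((a1 x^2+b1 x^2) + (a x^2+b x^2)))
    ≤ ∫ x in (0:ℝ)..R, (1 - x * q)^4 * (3 - 2 * exp (-x/2) - exp (-x/2)^2) *
        (c x * b1 x + a x * d1 x - d x * a1 x - b x * c1 x) := by
  have ca : Continuous a := continuous_iff_continuousAt.2 fun x => (da x).continuousAt
  have ca1 : Continuous a1 := continuous_iff_continuousAt.2 fun x => (da1 x).continuousAt
  have cb : Continuous b := continuous_iff_continuousAt.2 fun x => (db x).continuousAt
  have cb1 : Continuous b1 := continuous_iff_continuousAt.2 fun x => (db1 x).continuousAt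
  have cc : Continuous c := continuous_iff_continuousAt.2 fun x => (dc x).continuousAt
  have cd : Continuous d := continuous_iff_continuousAt.2 fun x => (dd x).continuousAt
  have hRq : R * q = 1 := by rw [hq]; exact mul_inv_cancel₀ (by linarith)
  have hq0 : 0 ≤ q := by rw [hq]; positivity
  have hq1 : q ≤ 1 := by rw [hq]; exact inv_le_one_of_one_le₀ hR
  set h : ℝ → ℝ := fun x => a x ^ 2 + b x ^ 2 with hh
  set n : ℝ → ℝ := fun x => a1 x ^ 2 + b1 x ^ 2 with hn
  set m : ℝ → ℝ := fun x => a x * a1 x + b x * b1 x with hm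
  have h0 : h 0 = 0 := by simp [hh, a0, b0]
  have m0 : m 0 = 0 := by simp [hm, a0, b0]
  have hpos : ∀ x, 0 ≤ h x := fun x => by simp only [hh]; positivity
  have dh : ∀ x, HasDerivAt h (2 * m x) x := fun x => by
    have := ((da x).pow 2).add ((db x).pow 2)
    refine HasDerivAt.congr_deriv this ?_
    simp only [hm]; push_cast; ring
  have dn : ∀ x, HasDerivAt n (2 * (a1 x * a2 x + b1 x * b2 x)) x := fun x => by
    have := ((da1 x).pow 2).add ((db1 x).pow 2)
    refine HasDerivAt.congr_deriv this ?_
    push_cast; ring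
  have dm : ∀ x, HasDerivAt m (a x * a2 x + b x * b2 x + n x) x := fun x => by
    have := ((da x).mul (da1 x)).add ((db x).mul (db1 x))
    refine HasDerivAt.congr_deriv this ?_
    simp only [hn]; ring
  have ch : Continuous h := by fun_prop
  have cn : Continuous n := by fun_prop
  have cm : Continuous m := by fun_prop
  -- the primitive G
  set k' : ℝ → ℝ := fun x => 2 * ((a2 x - d x) * a1 x + (b2 x + c x) * b1 x) with hk'
  have ck' : Continuous k' := by fun_prop
  have hk'eq : ∀ x, k' x = f (h x) * (2 * m x) := fun x => by
    have e1 := eqa x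
    have e2 := eqb x
    simp only [hk', hm, hh]
    linear_combination 2 * a1 x * e1 + 2 * b1 x * e2
  set G : ℝ → ℝ := fun x => ∫ y in (0:ℝ)..x, k' y with hG
  have dG : ∀ x, HasDerivAt G (k' x) x := fun x =>
    intervalIntegral.integral_hasDerivAt_right (ck'.intervalIntegrable _ _)
      ck'.aestronglyMeasurable.stronglyMeasurableAtFilter ck'.continuousAt
  have cG : Continuous G := continuous_iff_continuousAt.2 fun x => (dG x).continuousAt
  have hGb : ∀ x, |G x| ≤ C₀ * h x ^ r := fun x => by
    have := G_bound C₀ r hr hC f h (fun x => 2 * m x)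
      (fun x => (a2 x - d x) * a x + (b2 x + c x) * b x) dh (by fun_prop) (by fun_prop) hpos hf
      (fun x => by
        have e1 := eqa x
        have e2 := eqb x
        simp only [hh]
        linear_combination - a x * e1 - b x * e2) h0 x
    simp only [hG]
    simpa only [hk'eq] using this
  have hrP : ∀ x, h x ^ r = h x * h x ^ (r-1) := fun x => by
    have := Real.rpow_add_of_nonneg (hpos x) (show (0:ℝ) ≤ 1 by norm_num) (show 0 ≤ r - 1 by linarith)
    rw [Real.rpow_one] at this
    rw [← this]; congr 1; ring
  -- weights
  have dy : ∀ x : ℝ, HasDerivAt (fun x : ℝ => exp (-x/2)) (-(exp (-x/2))/2) x := fun x => by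
    have : HasDerivAt (fun x : ℝ => -x/2) (-1/2) x := ((hasDerivAt_id x).neg).div_const 2
    refine HasDerivAt.congr_deriv this.exp ?_; ring
  set y : ℝ → ℝ := fun x => exp (-x/2) with hy
  have cy : Continuous y := by fun_prop
  have ds : ∀ x : ℝ, HasDerivAt (fun x : ℝ => 1 - x * q) (-q) x := fun x => by
    have := ((hasDerivAt_id x).mul_const q).const_sub 1
    refine HasDerivAt.congr_deriv this ?_; ring
  set s : ℝ → ℝ := fun x => 1 - x * q with hs
  have cs : Continuous s := by fun_prop
  have sR : s R = 0 := by simp only [hs]; rw [hRq]; ring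
  have y0 : y 0 = 1 := by simp [hy]
  have dψ : ∀ x, HasDerivAt (fun x => 3 - 2 * y x - y x ^ 2) (y x + y x ^ 2) x := fun x => by
    have := (((dy x).const_mul 2).const_sub 3).sub ((dy x).pow 2)
    refine HasDerivAt.congr_deriv this ?_; push_cast; ring
  have dψ1 : ∀ x, HasDerivAt (fun x => y x + y x ^ 2) (-(y x / 2 + y x ^ 2)) x := fun x => by
    have := (dy x).add ((dy x).pow 2)
    refine HasDerivAt.congr_deriv this ?_; push_cast; ring
  have dψ2 : ∀ x, HasDerivAt (fun x => (y x / 2 + y x ^ 2)) (-(y x / 4 + y x ^ 2)) x := fun x => by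
    have := (((dy x).div_const 2)).add ((dy x).pow 2)
    refine HasDerivAt.congr_deriv this ?_; push_cast; ring
  have ds4 : ∀ x, HasDerivAt (fun x => s x ^ 4) (-4 * s x ^ 3 * q) x := fun x => by
    have := (ds x).pow 4
    refine HasDerivAt.congr_deriv this ?_; push_cast; ring
  have ds3 : ∀ x, HasDerivAt (fun x => s x ^ 3) (-3 * s x ^ 2 * q) x := fun x => by
    have := (ds x).pow 3
    refine HasDerivAt.congr_deriv this ?_; push_cast; ring
  have ds2 : ∀ x, HasDerivAt (fun x => s x ^ 2) (-2 * s x * q) x := fun x => by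
    have := (ds x).pow 2
    refine HasDerivAt.congr_deriv this ?_; push_cast; ring
  set ρ : ℝ → ℝ := fun x => s x ^ 4 * (3 - 2 * y x - y x ^ 2) with hρ
  set ρ1 : ℝ → ℝ := fun x => s x ^ 4 * (y x + y x ^ 2) - 4 * s x ^ 3 * q * (3 - 2 * y x - y x ^ 2) with hρ1
  set ρ2 : ℝ → ℝ := fun x => -(s x ^ 4 * (y x / 2 + y x ^ 2)) - 8 * q * (s x ^ 3 * (y x + y x ^ 2))
    + 12 * q ^ 2 * (s x ^ 2 * (3 - 2 * y x - y x ^ 2)) with hρ2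
  set ρ3 : ℝ → ℝ := fun x => s x^4*(y x/4+y x^2) + 3*(-4*s x^3*q)*(-(y x/2+y x^2))
    + 3*(12*s x^2*q^2)*(y x+y x^2) - 24*s x*q^3*(3-2*y x-y x^2) with hρ3
  have dρ : ∀ x, HasDerivAt ρ (ρ1 x) x := fun x => by
    have := (ds4 x).mul (dψ x)
    refine HasDerivAt.congr_deriv this ?_; simp only [hρ1]; ring
  have dρ1 : ∀ x, HasDerivAt ρ1 (ρ2 x) x := fun x => by
    have := ((ds4 x).mul (dψ1 x)).sub ((((ds3 x).const_mul 4).mul_const q).mul (dψ x))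
    refine HasDerivAt.congr_deriv this ?_; simp only [hρ2]; ring
  have dρ2 : ∀ x, HasDerivAt ρ2 (ρ3 x) x := fun x => by
    have := ((((ds4 x).mul (dψ2 x)).neg).sub (((ds3 x).mul (dψ1 x)).const_mul (8*q))).add
      (((ds2 x).mul (dψ x)).const_mul (12*q^2))
    refine HasDerivAt.congr_deriv this ?_; simp only [hρ3]; ring
  have cρ : Continuous ρ := by fun_prop
  have cρ1 : Continuous ρ1 := by fun_prop
  have cρ3 : Continuous ρ3 := by fun_prop
  have cP : Continuous (fun x => h x ^ (r-1)) := ch.rpow_const (fun x => Or.inr (by linarith))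
  set W : ℝ → ℝ := fun x => a x * d x - b x * c x - n x + G x with hW
  have dW : ∀ x, HasDerivAt W (c x * b1 x + a x * d1 x - d x * a1 x - b x * c1 x) x := fun x => by
    have := ((((da x).mul (dd x)).sub ((db x).mul (dc x))).sub (dn x)).add (dG x)
    refine HasDerivAt.congr_deriv this ?_; simp only [hk']; ring
  set Mt : ℝ → ℝ := fun x => c x * b1 x + a x * d1 x - d x * a1 x - b x * c1 x with hMt
  have cMt : Continuous Mt := by fun_prop
  have dr : ∀ x, HasDerivAt (fun x => h x ^ r) (2 * m x * r * h x ^ (r-1)) x := fun x =>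
    (dh x).rpow_const (Or.inr hr.le)
  set Y : ℝ → ℝ := fun x => ρ x * W x - ρ1 x * m x + 1/2 * (ρ2 x * h x)
    + s x ^ 4 * ((y x / 2 + y x ^ 2) * h x) - κ * (s x ^ 4 * (y x * h x ^ r)) with hY
  set E : ℝ → ℝ := fun x => ρ1 x * (2 * n x + (f (h x) * h x - G x))
      - 1/2 * ρ3 x * h x
      - (-4*s x^3*q*((y x/2+y x^2)*h x)
          + s x^4 * ((y x/2+y x^2) * (2 * m x) - (y x/4+y x^2) * h x))
      + κ * (-4*s x^3*q*(y x*(h x * h x ^ (r-1)))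
          + s x^4*(y x * (2 * m x) * r * h x ^ (r-1) - y x/2 * (h x * h x ^ (r-1)))) with hE
  have dY : ∀ x, HasDerivAt Y (ρ x * Mt x - E x) x := fun x => by
    have := (((((dρ x).mul (dW x)).sub ((dρ1 x).mul (dm x))).add
      (((dρ2 x).mul (dh x)).const_mul (1/2))).add ((ds4 x).mul ((dψ2 x).mul (dh x)))).sub
      (((ds4 x).mul ((dy x).mul (dr x))).const_mul κ)
    refine HasDerivAt.congr_deriv this ?_
    have e1 := eqa x
    have e2 := eqb x
    have e3 : f (h x) * h x = a x * (a2 x - d x) + b x * (b2 x + c x) := by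
      simp only [hh]; linear_combination - a x * e1 - b x * e2
    have e4 := hrP x
    have e5 : E x = ρ1 x * (2 * n x + (f (h x) * h x - G x))
      - 1/2 * ρ3 x * h x
      - (-4*s x^3*q*((y x/2+y x^2)*h x)
          + s x^4 * ((y x/2+y x^2) * (2 * m x) - (y x/4+y x^2) * h x))
      + κ * (-4*s x^3*q*(y x*(h x * h x ^ (r-1)))
          + s x^4*(y x * (2 * m x) * r * h x ^ (r-1) - y x/2 * (h x * h x ^ (r-1)))) := rfl
    have e6 : W x = a x * d x - b x * c x - n x + G x := rfl
    have e7 : Mt x = c x * b1 x + a x * d1 x - d x * a1 x - b x * c1 x := rfl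
    have e8 : exp (-x/2) = y x := rfl
    simp only [Pi.mul_apply]
    rw [e5, e4, e3, e6, e7, e8]
    ring
  have hg : Continuous (fun x => f (h x) * h x) := by
    have e : (fun x => f (h x) * h x) = fun x => a x * (a2 x - d x) + b x * (b2 x + c x) := by
      funext x
      have e1 := eqa x
      have e2 := eqb x
      simp only [hh]; linear_combination - a x * e1 - b x * e2
    rw [e]; fun_prop
  have cE : Continuous E := by fun_prop
  have hInteg : ∫ x in (0:ℝ)..R, (ρ x * Mt x - E x) = 0 := by
    rw [intervalIntegral.integral_eq_sub_of_hasDerivAt (f := Y) (fun x _ => dY x)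
      (Continuous.intervalIntegrable (by fun_prop) _ _)]
    have hz : (0:ℝ) ^ r = 0 := Real.zero_rpow (by linarith)
    have ρ0 : ρ 0 = 0 := by simp only [hρ, y0]; ring
    have YR : Y R = 0 := by simp only [hY, hρ, hρ1, hρ2, sR]; ring
    have Y0 : Y 0 = 0 := by simp only [hY, ρ0, m0, h0, hz]; ring
    rw [YR, Y0, sub_zero]
  rw [intervalIntegral.integral_sub (Continuous.intervalIntegrable (by fun_prop) _ _)
    (cE.intervalIntegrable _ _), sub_eq_zero] at hInteg
  have hInteg' : (∫ x in (0:ℝ)..R, (1 - x * q)^4 * (3 - 2 * exp (-x/2) - exp (-x/2)^2) *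
        (c x * b1 x + a x * d1 x - d x * a1 x - b x * c1 x)) = ∫ x in (0:ℝ)..R, E x := hInteg
  rw [hInteg', ← intervalIntegral.integral_const_mul, ← intervalIntegral.integral_const_mul,
    ← intervalIntegral.integral_sub (Continuous.intervalIntegrable (by fun_prop) _ _)
      (Continuous.intervalIntegrable (by fun_prop) _ _)]
  apply intervalIntegral.integral_mono_on (by linarith)
    (Continuous.intervalIntegrable (by fun_prop) _ _) (cE.intervalIntegrable _ _)
  intro x hx
  have hs0 : 0 ≤ s x := by
    have : x * q ≤ R * q := mul_le_mul_of_nonneg_right hx.2 hq0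
    simp only [hs]; linarith
  have hs1 : s x ≤ 1 := by
    have : 0 ≤ x * q := mul_nonneg hx.1 hq0
    simp only [hs]; linarith
  have hy1 : y x ≤ 1 := by
    simp only [hy]; apply Real.exp_le_one_iff.mpr; linarith [hx.1]
  have hN : |f (h x) * h x - G x| ≤ 2 * C₀ * (h x * h x ^ (r-1)) := by
    have i1 : |f (h x) * h x| ≤ C₀ * h x ^ (r-1) * h x := by
      rw [abs_mul, abs_of_nonneg (hpos x)]
      exact mul_le_mul_of_nonneg_right (hf _ (hpos x)) (hpos x)
    have i2 := hGb x
    rw [hrP] at i2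
    have i3 := abs_sub (f (h x) * h x) (G x)
    linarith
  have := point_alg (a x) (b x) (a1 x) (b1 x) (y x) (s x) q r C₀ κ (h x ^ (r-1))
    (f (h x) * h x - G x) hr hC (exp_pos _).le hy1 (Real.rpow_nonneg (hpos x) _) (hP x hx).1 hs0 hs1
    hq0 hq1 hN hκ hκ0 (hP x hx).2
  exact this

open scoped ContDiff

/-- partial derivative in the second (space) variable -/
noncomputable def px (F : ℝ × ℝ → ℝ) (p : ℝ × ℝ) : ℝ := fderiv ℝ F p (0, 1)

/-- partial derivative in the first (time) variable -/
noncomputable def pt (F : ℝ × ℝ → ℝ) (p : ℝ × ℝ) : ℝ := fderiv ℝ F p (1, 0)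

lemma px_smooth {F : ℝ × ℝ → ℝ} (hF : ContDiff ℝ ∞ F) : ContDiff ℝ ∞ (px F) :=
  (hF.fderiv_right (m := ∞) (by simp)).clm_apply contDiff_const

lemma pt_smooth {F : ℝ × ℝ → ℝ} (hF : ContDiff ℝ ∞ F) : ContDiff ℝ ∞ (pt F) :=
  (hF.fderiv_right (m := ∞) (by simp)).clm_apply contDiff_const

lemma px_hasDerivAt {F : ℝ × ℝ → ℝ} (hF : ContDiff ℝ ∞ F) (t x : ℝ) :
    HasDerivAt (fun x => F (t, x)) (px F (t, x)) x := by
  have h1 : HasFDerivAt F (fderiv ℝ F (t, x)) (t, x) :=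
    (hF.differentiable (by simp)).differentiableAt.hasFDerivAt
  have h2 : HasDerivAt (fun x : ℝ => (t, x)) ((0:ℝ), (1:ℝ)) x :=
    (hasDerivAt_const x t).prodMk (hasDerivAt_id x)
  exact h1.comp_hasDerivAt x h2

lemma pt_hasDerivAt {F : ℝ × ℝ → ℝ} (hF : ContDiff ℝ ∞ F) (t x : ℝ) :
    HasDerivAt (fun t => F (t, x)) (pt F (t, x)) t := by
  have h1 : HasFDerivAt F (fderiv ℝ F (t, x)) (t, x) :=
    (hF.differentiable (by simp)).differentiableAt.hasFDerivAt
  have h2 : HasDerivAt (fun t : ℝ => (t, x)) ((1:ℝ), (0:ℝ)) t :=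
    (hasDerivAt_id t).prodMk (hasDerivAt_const t x)
  exact h1.comp_hasDerivAt t h2

lemma px_pt {F : ℝ × ℝ → ℝ} (hF : ContDiff ℝ ∞ F) (p : ℝ × ℝ) : px (pt F) p = pt (px F) p := by
  have hs : IsSymmSndFDerivAt ℝ F p := by
    apply (hF.contDiffAt (x := p)).isSymmSndFDerivAt
    simp only [minSmoothness_of_isRCLikeNormedField]
    exact WithTop.coe_le_coe.2 (le_top : (2:ℕ∞) ≤ ⊤)
  have hd : DifferentiableAt ℝ (fderiv ℝ F) p :=
    ((hF.fderiv_right (m := ∞) (by simp)).differentiable (by simp)).differentiableAt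
  have e : ∀ v w : ℝ × ℝ, fderiv ℝ (fun q => fderiv ℝ F q v) p w = fderiv ℝ (fderiv ℝ F) p w v := by
    intro v w
    rw [fderiv_clm_apply hd (differentiableAt_const v)]
    simp
  show fderiv ℝ (fun q => fderiv ℝ F q (1,0)) p (0,1) = fderiv ℝ (fun q => fderiv ℝ F q (0,1)) p (1,0)
  rw [e, e]
  exact hs.eq _ _

lemma spacetime (r C₀ κ R T q ε : ℝ) (hr : 1 < r) (hC : 0 ≤ C₀) (hκ : κ * (r-1) = 16 * C₀)
    (hκ0 : 0 ≤ κ) (hR : 1 ≤ R) (hT : 0 ≤ T) (hq : q = R⁻¹) (hε0 : 0 ≤ ε) (hε1 : ε ≤ 1)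
    (hsmall : 64 * C₀ * r^2 * (ε^2) ^ (r-1) ≤ (r-1)^2)
    (f : ℝ → ℝ) (hf : ∀ s : ℝ, 0 ≤ s → |f s| ≤ C₀ * s ^ (r - 1))
    (A B : ℝ × ℝ → ℝ) (hA : ContDiff ℝ ∞ A) (hB : ContDiff ℝ ∞ B)
    (eqa : ∀ p, - pt B p + px (px A) p = f (A p ^ 2 + B p ^ 2) * A p)
    (eqb : ∀ p, pt A p + px (px B) p = f (A p ^ 2 + B p ^ 2) * B p)
    (a0 : ∀ t, A (t, 0) = 0) (b0 : ∀ t, B (t, 0) = 0)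
    (hE : ∀ t X, 0 ≤ X → ∫ x in (0:ℝ)..X, ((px A (t,x)^2 + px B (t,x)^2) + (A (t,x)^2 + B (t,x)^2)) ≤ ε^2) :
    1/50 * ∫ t in (0:ℝ)..T, (∫ x in (0:ℝ)..R, (1 - x * q)^4 * exp (-x/2)^2 *
      ((px A (t,x)^2 + px B (t,x)^2) + (A (t,x)^2 + B (t,x)^2)))
    ≤ 3 * ε^2 + T * ((105 + 24 * C₀ + 4 * κ) * q * ε^2) := by
  have hR0 : 0 ≤ R := by linarith
  have hRq : R * q = 1 := by rw [hq]; exact mul_inv_cancel₀ (by linarith)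
  have hq0 : 0 ≤ q := by rw [hq]; positivity
  have sA := px_smooth hA
  have sB := px_smooth hB
  have tA := pt_smooth hA
  have tB := pt_smooth hB
  have cA := hA.continuous
  have cB := hB.continuous
  have cA1 := sA.continuous
  have cB1 := sB.continuous
  have cAt := tA.continuous
  have cBt := tB.continuous
  have cAtx := (px_smooth tA).continuous
  have cBtx := (px_smooth tB).continuous
  have cA2 := (px_smooth sA).continuous
  have cB2 := (px_smooth sB).continuous
  -- sup bound
  have hsup : ∀ t x, 0 ≤ x → A (t,x)^2 + B (t,x)^2 ≤ ε^2 := by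
    intro t x hx
    refine le_trans ?_ (hE t x hx)
    have hd : ∀ z, HasDerivAt (fun z => A (t,z)^2 + B (t,z)^2)
        (2 * (A (t,z) * px A (t,z) + B (t,z) * px B (t,z))) z := fun z => by
      have := ((px_hasDerivAt hA t z).pow 2).add ((px_hasDerivAt hB t z).pow 2)
      refine HasDerivAt.congr_deriv this ?_
      push_cast; ring
    have := intervalIntegral.integral_eq_sub_of_hasDerivAt (a := 0) (b := x) (fun z _ => hd z)
      (Continuous.intervalIntegrable (by fun_prop) _ _)
    have e : A (t,x)^2 + B (t,x)^2 = ∫ z in (0:ℝ)..x, 2 * (A (t,z) * px A (t,z) + B (t,z) * px B (t,z)) := by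
      rw [this, a0, b0]; ring
    rw [e]
    apply intervalIntegral.integral_mono_on hx (Continuous.intervalIntegrable (by fun_prop) _ _)
      (Continuous.intervalIntegrable (by fun_prop) _ _)
    intro z _
    nlinarith [sq_nonneg (A (t,z) - px A (t,z)), sq_nonneg (B (t,z) - px B (t,z))]
  have hP : ∀ t, ∀ x ∈ Set.Icc 0 R, (A (t,x) ^ 2 + B (t,x) ^ 2) ^ (r-1) ≤ 1 ∧
      64 * C₀ * r^2 * (A (t,x) ^ 2 + B (t,x) ^ 2) ^ (r-1) ≤ (r-1)^2 := by
    intro t x hx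
    have h1 : (A (t,x) ^ 2 + B (t,x) ^ 2) ^ (r-1) ≤ (ε^2)^(r-1) :=
      Real.rpow_le_rpow (by positivity) (hsup t x hx.1) (by linarith)
    refine ⟨Real.rpow_le_one (by positivity) ((hsup t x hx.1).trans (pow_le_one₀ hε0 hε1)) (by linarith), ?_⟩
    refine le_trans ?_ hsmall
    gcongr
  -- momentum density
  set M : ℝ → ℝ → ℝ := fun t x => A (t,x) * px B (t,x) - B (t,x) * px A (t,x) with hM
  set Mt : ℝ → ℝ → ℝ := fun t x => pt A (t,x) * px B (t,x) + A (t,x) * px (pt B) (t,x)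
    - pt B (t,x) * px A (t,x) - B (t,x) * px (pt A) (t,x) with hMt
  set ρ : ℝ → ℝ := fun x => (1 - x * q)^4 * (3 - 2 * exp (-x/2) - exp (-x/2)^2) with hρ
  have dM : ∀ t x, HasDerivAt (fun t => ρ x * M t x) (ρ x * Mt t x) t := fun t x => by
    have := (((pt_hasDerivAt hA t x).mul (pt_hasDerivAt sB t x)).sub
      ((pt_hasDerivAt hB t x).mul (pt_hasDerivAt sA t x))).const_mul (ρ x)
    refine HasDerivAt.congr_deriv this ?_
    simp only [hMt, px_pt hA, px_pt hB]; ring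
  have cMt : Continuous (fun p : ℝ × ℝ => ρ p.2 * Mt p.1 p.2) := by
    simp only [hMt, hρ]; fun_prop
  have hρb : ∀ x ∈ Set.Icc 0 R, 0 ≤ ρ x ∧ ρ x ≤ 3 := by
    intro x hx
    have hs0 : 0 ≤ 1 - x * q := by
      have : x * q ≤ R * q := mul_le_mul_of_nonneg_right hx.2 hq0
      linarith
    have hs1 : 1 - x * q ≤ 1 := by
      have : 0 ≤ x * q := mul_nonneg hx.1 hq0
      linarith
    have hy1 : exp (-x/2) ≤ 1 := by
      apply Real.exp_le_one_iff.mpr; linarith [hx.1]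
    have hy0 : 0 < exp (-x/2) := exp_pos _
    have k1 : 0 ≤ 3 - 2 * exp (-x/2) - exp (-x/2)^2 := by nlinarith
    have k2 : 3 - 2 * exp (-x/2) - exp (-x/2)^2 ≤ 3 := by nlinarith
    refine ⟨by positivity, ?_⟩
    calc ρ x ≤ 1 * 3 := mul_le_mul (pow_le_one₀ hs0 hs1) k2 k1 (by norm_num)
      _ = 3 := by norm_num
  have hJ : ∀ t, |∫ x in (0:ℝ)..R, ρ x * M t x| ≤ 3/2 * ε^2 := by
    intro t
    have h1 : |∫ x in (0:ℝ)..R, ρ x * M t x| ≤ ∫ x in (0:ℝ)..R, |ρ x * M t x| :=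
      intervalIntegral.abs_integral_le_integral_abs hR0
    have h2 : ∫ x in (0:ℝ)..R, |ρ x * M t x| ≤ ∫ x in (0:ℝ)..R, 3/2 *
        ((px A (t,x)^2 + px B (t,x)^2) + (A (t,x)^2 + B (t,x)^2)) := by
      apply intervalIntegral.integral_mono_on hR0
        (Continuous.intervalIntegrable (by simp only [hM, hρ]; fun_prop) _ _)
        (Continuous.intervalIntegrable (by fun_prop) _ _)
      intro x hx
      rw [abs_mul, abs_of_nonneg (hρb x hx).1]
      have i1 : |M t x| ≤ 1/2 * ((px A (t,x)^2 + px B (t,x)^2) + (A (t,x)^2 + B (t,x)^2)) := by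
        simp only [hM]
        rw [abs_le]
        constructor
        · nlinarith [sq_nonneg (A (t,x) + px B (t,x)), sq_nonneg (B (t,x) - px A (t,x))]
        · nlinarith [sq_nonneg (A (t,x) - px B (t,x)), sq_nonneg (B (t,x) + px A (t,x))]
      calc ρ x * |M t x| ≤ 3 * (1/2 * ((px A (t,x)^2 + px B (t,x)^2) + (A (t,x)^2 + B (t,x)^2))) :=
            mul_le_mul (hρb x hx).2 i1 (abs_nonneg _) (by norm_num)
        _ = _ := by ring
    rw [intervalIntegral.integral_const_mul] at h2
    have := hE t R hR0
    linarith
  have hswap : ∫ t in (0:ℝ)..T, ∫ x in (0:ℝ)..R, ρ x * Mt t x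
      = (∫ x in (0:ℝ)..R, ρ x * M T x) - ∫ x in (0:ℝ)..R, ρ x * M 0 x := by
    rw [MeasureTheory.intervalIntegral_intervalIntegral_swap]
    · rw [← intervalIntegral.integral_sub
        (Continuous.intervalIntegrable (by simp only [hM, hρ]; fun_prop) _ _)
        (Continuous.intervalIntegrable (by simp only [hM, hρ]; fun_prop) _ _)]
      apply intervalIntegral.integral_congr
      intro x _
      exact intervalIntegral.integral_eq_sub_of_hasDerivAt (fun t _ => dM t x)
        (Continuous.intervalIntegrable (by simp only [hMt]; fun_prop) _ _)
    · have : IntegrableOn (fun p : ℝ × ℝ => ρ p.2 * Mt p.1 p.2) (Set.uIcc 0 T ×ˢ Set.uIcc 0 R) :=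
        cMt.continuousOn.integrableOn_compact (isCompact_uIcc.prod isCompact_uIcc)
      exact this.mono_set (Set.prod_mono Set.uIoc_subset_uIcc Set.uIoc_subset_uIcc)
  have hmain : ∫ t in (0:ℝ)..T, (1/50 * (∫ x in (0:ℝ)..R, (1 - x * q)^4 * exp (-x/2)^2 *
      ((px A (t,x)^2 + px B (t,x)^2) + (A (t,x)^2 + B (t,x)^2)))
        - (105 + 24 * C₀ + 4 * κ) * q * ε^2) ≤ ∫ t in (0:ℝ)..T, ∫ x in (0:ℝ)..R, ρ x * Mt t x := by
    apply intervalIntegral.integral_mono_on hT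
    · apply Continuous.intervalIntegrable
      apply Continuous.sub _ continuous_const
      apply Continuous.mul continuous_const
      apply intervalIntegral.continuous_parametric_intervalIntegral_of_continuous'
      fun_prop
    · apply Continuous.intervalIntegrable
      apply intervalIntegral.continuous_parametric_intervalIntegral_of_continuous'
      exact cMt
    · intro t _
      have := fixed_time r C₀ κ R q hr hC hκ hκ0 hR hq f hf
        (fun x => A (t,x)) (fun x => px A (t,x)) (fun x => px (px A) (t,x))
        (fun x => B (t,x)) (fun x => px B (t,x)) (fun x => px (px B) (t,x))
        (fun x => pt A (t,x)) (fun x => px (pt A) (t,x))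
        (fun x => pt B (t,x)) (fun x => px (pt B) (t,x))
        (px_hasDerivAt hA t) (px_hasDerivAt sA t) (px_hasDerivAt hB t) (px_hasDerivAt sB t)
        (px_hasDerivAt tA t) (px_hasDerivAt tB t) (by fun_prop) (by fun_prop) (by fun_prop)
        (by fun_prop) (fun x => eqa (t,x)) (fun x => eqb (t,x)) (a0 t) (b0 t) (hP t)
      have h2 : (105 + 24 * C₀ + 4 * κ) * q * (∫ x in (0:ℝ)..R,
         ((px A (t,x)^2 + px B (t,x)^2) + (A (t,x)^2 + B (t,x)^2))) ≤ (105 + 24 * C₀ + 4 * κ) * q * ε^2 :=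
        mul_le_mul_of_nonneg_left (hE t R hR0) (by positivity)
      simp only [hρ, hMt]
      linarith
  rw [hswap, intervalIntegral.integral_sub, intervalIntegral.integral_const_mul,
    intervalIntegral.integral_const, smul_eq_mul, sub_zero] at hmain
  · have j1 := (abs_le.mp (hJ T)).2
    have j2 := (abs_le.mp (hJ 0)).1
    linarith
  · apply Continuous.intervalIntegrable
    apply Continuous.mul continuous_const
    apply intervalIntegral.continuous_parametric_intervalIntegral_of_continuous'
    fun_prop
  · exact continuous_const.intervalIntegrable _ _

lemma exists_eps (C₀ r : ℝ) (hr : 1 < r) :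
    ∃ ε : ℝ, 0 < ε ∧ ε ≤ 1 ∧ 64 * C₀ * r^2 * (ε^2) ^ (r-1) ≤ (r-1)^2 := by
  have hc : ContinuousAt (fun ε : ℝ => 64 * C₀ * r^2 * (ε^2) ^ (r-1)) 0 := by
    apply ContinuousAt.mul continuousAt_const
    exact (continuousAt_id.pow 2).rpow_const (Or.inr (by linarith))
  have h0 : 64 * C₀ * r^2 * ((0:ℝ)^2) ^ (r-1) < (r-1)^2 := by
    rw [zero_pow (by norm_num), Real.zero_rpow (by linarith), mul_zero]
    have : 0 < r - 1 := by linarith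
    positivity
  have h1 := hc.eventually_lt_const h0
  obtain ⟨δ, hδ, hb⟩ := Metric.eventually_nhds_iff.mp h1
  refine ⟨min (δ/2) 1, by positivity, min_le_right _ _, (hb ?_).le⟩
  rw [Real.dist_eq, sub_zero, abs_of_pos (by positivity)]
  exact lt_of_le_of_lt (min_le_left _ _) (by linarith)

lemma half_line_bound (g : ℝ → ℝ) (hg : Continuous g) (hpos : ∀ x, 0 ≤ g x)
    (heven : ∀ x, g (-x) = g x) (N : ℝ) (hN : 0 < N) :
    ∫ x in (-N)..N, (1 / Real.cosh x) * g x ≤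
      64 * ∫ x in (0:ℝ)..(2*N), (1 - x * (2*N)⁻¹)^4 * exp (-x/2)^2 * g x := by
  have hcosh : Continuous (fun x : ℝ => 1 / Real.cosh x) :=
    continuous_const.div Real.continuous_cosh (fun x => (Real.cosh_pos x).ne')
  have ci : Continuous (fun x : ℝ => (1 / Real.cosh x) * g x) := hcosh.mul hg
  have cj : Continuous (fun x : ℝ => (1 - x * (2*N)⁻¹)^4 * exp (-x/2)^2 * g x) := by fun_prop
  have e1 : ∫ x in (-N)..0, (1 / Real.cosh x) * g x = ∫ x in (0:ℝ)..N, (1 / Real.cosh x) * g x := by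
    have := intervalIntegral.integral_comp_neg (a := 0) (b := N) (fun x => (1 / Real.cosh x) * g x)
    simp only [Real.cosh_neg, heven, neg_zero] at this
    exact this.symm
  rw [← intervalIntegral.integral_add_adjacent_intervals (b := 0) (ci.intervalIntegrable _ _)
    (ci.intervalIntegrable _ _), e1]
  have h1 : ∫ x in (0:ℝ)..N, (1 / Real.cosh x) * g x ≤
      ∫ x in (0:ℝ)..N, 32 * ((1 - x * (2*N)⁻¹)^4 * exp (-x/2)^2 * g x) := by
    apply intervalIntegral.integral_mono_on hN.le (ci.intervalIntegrable _ _)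
      ((continuous_const.mul cj).intervalIntegrable _ _)
    intro x hx
    show (1 / Real.cosh x) * g x ≤ 32 * ((1 - x * (2*N)⁻¹)^4 * exp (-x/2)^2 * g x)
    rw [← mul_assoc 32]
    apply mul_le_mul_of_nonneg_right _ (hpos x)
    have hs : 1/2 ≤ 1 - x * (2*N)⁻¹ := by
      have : x * (2*N)⁻¹ ≤ N * (2*N)⁻¹ := mul_le_mul_of_nonneg_right hx.2 (by positivity)
      have e : N * (2*N)⁻¹ = 1/2 := by field_simp
      linarith
    have hs4 : (1/2:ℝ)^4 ≤ (1 - x * (2*N)⁻¹)^4 := pow_le_pow_left₀ (by norm_num) hs 4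
    have hexp : exp (-x/2)^2 = exp (-x) := by
      rw [← Real.exp_nat_mul]; congr 1; push_cast; ring
    have hc : 1 / Real.cosh x ≤ 2 * exp (-x) := by
      rw [div_le_iff₀ (Real.cosh_pos x), Real.cosh_eq]
      have e : exp (-x) * exp x = 1 := by rw [← Real.exp_add]; simp
      nlinarith [exp_pos (-x)]
    rw [hexp]
    nlinarith [mul_le_mul_of_nonneg_right hs4 (exp_pos (-x)).le]
  have h2 : ∫ x in (0:ℝ)..N, ((1 - x * (2*N)⁻¹)^4 * exp (-x/2)^2 * g x) ≤
      ∫ x in (0:ℝ)..(2*N), ((1 - x * (2*N)⁻¹)^4 * exp (-x/2)^2 * g x) := by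
    rw [← intervalIntegral.integral_add_adjacent_intervals (b := N) (c := 2*N) (cj.intervalIntegrable _ _)
      (cj.intervalIntegrable _ _)]
    have : 0 ≤ ∫ x in N..(2*N), ((1 - x * (2*N)⁻¹)^4 * exp (-x/2)^2 * g x) := by
      apply intervalIntegral.integral_nonneg (by linarith)
      intro x _
      have := hpos x
      positivity
    linarith
  rw [intervalIntegral.integral_const_mul] at h1
  linarith

lemma fatou_step (Ψ : ℕ → ℝ → ℝ) (Φ : ℝ → ℝ) (K : ℝ) (hc : ∀ N, Continuous (Ψ N))
    (hpos : ∀ N t, 0 ≤ Ψ N t)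
    (hlim : ∀ t, Filter.Tendsto (fun N => Ψ N t) Filter.atTop (nhds (Φ t)))
    (hb : ∀ N : ℕ, 1 ≤ N → ∫ t in (0:ℝ)..N, Ψ N t ≤ K) :
    ∫⁻ t in Set.Ici (0:ℝ), ENNReal.ofReal (Φ t) ≤ ENNReal.ofReal K := by
  set F : ℕ → ℝ → ENNReal := fun N => (Set.Iic (N:ℝ)).indicator (fun t => ENNReal.ofReal (Ψ N t))
  have hF : ∀ N, Measurable (F N) := fun N =>
    (ENNReal.measurable_ofReal.comp (hc N).measurable).indicator measurableSet_Iic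
  have hl : ∀ t, ENNReal.ofReal (Φ t) = Filter.liminf (fun N => F N t) Filter.atTop := by
    intro t
    symm
    apply Filter.Tendsto.liminf_eq
    have h1 := ENNReal.tendsto_ofReal (hlim t)
    apply h1.congr'
    filter_upwards [Filter.eventually_ge_atTop ⌈t⌉₊] with N hN
    have : t ≤ N := (Nat.le_ceil t).trans (by exact_mod_cast hN)
    simp only [F]
    rw [Set.indicator_of_mem]
    exact this
  simp_rw [hl]
  refine (lintegral_liminf_le hF).trans ?_
  have hb' : ∀ N : ℕ, 1 ≤ N → ∫⁻ t in Set.Ici (0:ℝ), F N t ≤ ENNReal.ofReal K := by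
    intro N hN
    simp only [F]
    rw [lintegral_indicator measurableSet_Iic, Measure.restrict_restrict measurableSet_Iic]
    have e : Set.Iic (N:ℝ) ∩ Set.Ici 0 = Set.Icc 0 (N:ℝ) := by
      ext x; simp [and_comm]
    rw [e, ← ofReal_integral_eq_lintegral_ofReal]
    · apply ENNReal.ofReal_le_ofReal
      rw [integral_Icc_eq_integral_Ioc, ← intervalIntegral.integral_of_le (by positivity)]
      exact hb N hN
    · exact (hc N).continuousOn.integrableOn_compact isCompact_Icc
    · exact Filter.Eventually.of_forall (hpos N)
  refine Filter.liminf_le_of_le (by isBoundedDefault) ?_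
  intro b hbb
  obtain ⟨N, h1, h2⟩ := (hbb.and (Filter.eventually_ge_atTop 1)).exists
  exact h1.trans (hb' N h2)

/-- Proposition 2.5: time-integrability of the weighted H¹ norm for small odd
solutions of NLS. -/
theorem time_integrability_NLS
    (p C₀ : ℝ) (hp1 : 1 < p) (hp5 : p < 5)
    (f : ℝ → ℝ) (hf : ∀ s : ℝ, 0 ≤ s → |f s| ≤ C₀ * s ^ ((p - 1) / 2)) :
    ∃ ε > 0, ∃ C > 0, ∀ u : ℝ → ℝ → ℂ,
      ContDiff ℝ (⊤ : ℕ∞) (Function.uncurry u) →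
      (∀ t x : ℝ, Complex.I * deriv (fun s => u s x) t + deriv (deriv (u t)) x
          = (f (‖u t x‖ ^ 2) : ℂ) * u t x) →
      (∀ t x : ℝ, u t (-x) = - u t x) →
      (∀ t : ℝ, ∃ g : SchwartzMap ℝ ℂ, ∀ x : ℝ, u t x = g x) →
      (∀ t : ℝ, (∫ x : ℝ, ‖u t x‖ ^ 2) + (∫ x : ℝ, ‖deriv (u t) x‖ ^ 2) ≤ ε ^ 2) →
      ∫⁻ t in Set.Ici (0 : ℝ),
        ENNReal.ofReal (∫ x : ℝ, (1 / Real.cosh x) * (‖deriv (u t) x‖ ^ 2 + ‖u t x‖ ^ 2))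
      ≤ ENNReal.ofReal (C * ε ^ 2) := by
  obtain ⟨r, hrdef⟩ : ∃ r, r = (p+1)/2 := ⟨_, rfl⟩
  have hr : 1 < r := by rw [hrdef]; linarith
  have hr1 : 0 < r - 1 := by linarith
  have hrp : (p-1)/2 = r - 1 := by rw [hrdef]; ring
  rw [hrp] at hf
  have hC : 0 ≤ C₀ := by
    have := hf 1 (by norm_num)
    rw [Real.one_rpow, mul_one] at this
    exact (abs_nonneg _).trans this
  obtain ⟨κ, hκd⟩ : ∃ κ, κ = 16 * C₀ / (r-1) := ⟨_, rfl⟩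
  have hκ : κ * (r-1) = 16 * C₀ := by rw [hκd]; field_simp
  have hκ0 : 0 ≤ κ := by rw [hκd]; positivity
  obtain ⟨ε, hε, hε1, hsmall⟩ := exists_eps C₀ r hr
  refine ⟨ε, hε, 64 * (50 * (3 + (105 + 24 * C₀ + 4 * κ))), by positivity, ?_⟩
  intro u hu heq hodd hS hE
  set A : ℝ × ℝ → ℝ := fun p => (Function.uncurry u p).re with hAdef
  set B : ℝ × ℝ → ℝ := fun p => (Function.uncurry u p).im with hBdef
  have hA : ContDiff ℝ ∞ A := Complex.reCLM.contDiff.comp hu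
  have hB : ContDiff ℝ ∞ B := Complex.imCLM.contDiff.comp hu
  have huAB : ∀ t x, u t x = (A (t,x) : ℂ) + (B (t,x) : ℂ) * Complex.I := fun t x =>
    (Complex.re_add_im (u t x)).symm
  have dux : ∀ t x, HasDerivAt (u t) ((px A (t,x) : ℂ) + (px B (t,x) : ℂ) * Complex.I) x := by
    intro t x
    have := (px_hasDerivAt hA t x).ofReal_comp.add
      ((px_hasDerivAt hB t x).ofReal_comp.mul_const Complex.I)
    refine this.congr_of_eventuallyEq (Filter.Eventually.of_forall fun y => ?_)
    exact huAB t y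
  have dux2 : ∀ t x, HasDerivAt (deriv (u t))
      ((px (px A) (t,x) : ℂ) + (px (px B) (t,x) : ℂ) * Complex.I) x := by
    intro t x
    have := (px_hasDerivAt (px_smooth hA) t x).ofReal_comp.add
      ((px_hasDerivAt (px_smooth hB) t x).ofReal_comp.mul_const Complex.I)
    refine this.congr_of_eventuallyEq (Filter.Eventually.of_forall fun y => ?_)
    exact (dux t y).deriv
  have dut : ∀ t x, HasDerivAt (fun s => u s x)
      ((pt A (t,x) : ℂ) + (pt B (t,x) : ℂ) * Complex.I) t := by
    intro t x
    have := (pt_hasDerivAt hA t x).ofReal_comp.add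
      ((pt_hasDerivAt hB t x).ofReal_comp.mul_const Complex.I)
    refine this.congr_of_eventuallyEq (Filter.Eventually.of_forall fun y => ?_)
    exact huAB y x
  have hnorm : ∀ z w : ℝ, ‖(z : ℂ) + (w : ℂ) * Complex.I‖^2 = z^2 + w^2 := by
    intro z w
    rw [Complex.sq_norm, Complex.normSq_add_mul_I]
  have hnu : ∀ t x, ‖u t x‖^2 = A (t,x)^2 + B (t,x)^2 := fun t x => by
    rw [huAB, hnorm]
  have hndu : ∀ t x, ‖deriv (u t) x‖^2 = px A (t,x)^2 + px B (t,x)^2 := fun t x => by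
    rw [(dux t x).deriv, hnorm]
  have eqc : ∀ t x, - pt B (t,x) + px (px A) (t,x) = f (A (t,x) ^ 2 + B (t,x) ^ 2) * A (t,x) ∧
      pt A (t,x) + px (px B) (t,x) = f (A (t,x) ^ 2 + B (t,x) ^ 2) * B (t,x) := by
    intro t x
    have h1 := heq t x
    rw [(dut t x).deriv, (dux2 t x).deriv, hnu t x, huAB t x] at h1
    constructor
    · have := congrArg Complex.re h1
      simpa [-Complex.ofReal_add, -Complex.ofReal_pow] using this
    · have := congrArg Complex.im h1
      simpa [-Complex.ofReal_add, -Complex.ofReal_pow] using this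
  have oddA : ∀ t x, A (t,-x) = - A (t,x) := fun t x => by
    have := congrArg Complex.re (hodd t x)
    rw [Complex.neg_re] at this
    exact this
  have oddB : ∀ t x, B (t,-x) = - B (t,x) := fun t x => by
    have := congrArg Complex.im (hodd t x)
    rw [Complex.neg_im] at this
    exact this
  have evenpx : ∀ F : ℝ × ℝ → ℝ, ContDiff ℝ ∞ F → (∀ t x, F (t,-x) = - F (t,x)) →
      ∀ t x, px F (t,-x) = px F (t,x) := by
    intro F hF hFo t x
    have h1 := (px_hasDerivAt hF t (-x)).comp x (hasDerivAt_neg x)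
    have h2 := (px_hasDerivAt hF t x).neg
    have h3 : HasDerivAt (fun y => - F (t,y)) (px F (t,-x) * -1) x := by
      refine h1.congr_of_eventuallyEq (Filter.Eventually.of_forall fun y => ?_)
      exact (hFo t y).symm
    have := h3.unique h2
    linarith
  have cA := hA.continuous
  have cB := hB.continuous
  have cA1 := (px_smooth hA).continuous
  have cB1 := (px_smooth hB).continuous
  set g : ℝ → ℝ → ℝ := fun t x => (px A (t,x)^2 + px B (t,x)^2) + (A (t,x)^2 + B (t,x)^2) with hg
  have cg : Continuous (fun p : ℝ × ℝ => g p.1 p.2) := by simp only [hg]; fun_prop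
  have cgt : ∀ t, Continuous (g t) := fun t => by simp only [hg]; fun_prop
  have gpos : ∀ t x, 0 ≤ g t x := fun t x => by simp only [hg]; positivity
  have geven : ∀ t x, g t (-x) = g t x := fun t x => by
    simp only [hg, oddA, oddB, evenpx A hA oddA, evenpx B hB oddB]; ring
  have int1 : ∀ t, Integrable (fun x => ‖u t x‖^2) := by
    intro t
    obtain ⟨G, hG⟩ := hS t
    have : u t = G := funext hG
    rw [this]
    exact (G.memLp 2).integrable_norm_pow (by norm_num)
  have int2 : ∀ t, Integrable (fun x => ‖deriv (u t) x‖^2) := by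
    intro t
    obtain ⟨G, hG⟩ := hS t
    have : u t = G := funext hG
    rw [this]
    exact ((SchwartzMap.derivCLM ℝ ℂ G).memLp 2).integrable_norm_pow (by norm_num)
  have ig : ∀ t, Integrable (g t) := fun t => by
    have := (int2 t).add (int1 t)
    refine this.congr (Filter.Eventually.of_forall fun x => ?_)
    simp only [Pi.add_apply, hnu, hndu, hg]
  have igle : ∀ t, ∫ x, g t x ≤ ε^2 := fun t => by
    have h1 := hE t
    have e : ∫ x, g t x = (∫ x : ℝ, ‖u t x‖ ^ 2) + (∫ x : ℝ, ‖deriv (u t) x‖ ^ 2) := by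
      rw [← integral_add (int1 t) (int2 t)]
      congr 1
      funext x
      simp only [hnu, hndu, hg]; ring
    rw [e]; exact h1
  have hEX : ∀ t X, 0 ≤ X → ∫ x in (0:ℝ)..X, g t x ≤ ε^2 := by
    intro t X hX
    rw [intervalIntegral.integral_of_le hX]
    exact (setIntegral_le_integral (ig t) (Filter.Eventually.of_forall (gpos t))).trans (igle t)
  have a0 : ∀ t, A (t,0) = 0 := fun t => by
    have := oddA t 0
    rw [neg_zero] at this; linarith
  have b0 : ∀ t, B (t,0) = 0 := fun t => by
    have := oddB t 0
    rw [neg_zero] at this; linarith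
  have hcosh : Continuous (fun x : ℝ => 1 / Real.cosh x) :=
    continuous_const.div Real.continuous_cosh (fun x => (Real.cosh_pos x).ne')
  have hcosh1 : ∀ x : ℝ, 0 ≤ 1 / Real.cosh x := fun x => (one_div_pos.mpr (Real.cosh_pos x)).le
  have hInteg : ∀ t x, (1 / Real.cosh x) * (‖deriv (u t) x‖ ^ 2 + ‖u t x‖ ^ 2) =
      (1 / Real.cosh x) * g t x := fun t x => by rw [hnu, hndu]
  simp_rw [hInteg]
  have iw : ∀ t, Integrable (fun x => (1 / Real.cosh x) * g t x) := fun t => by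
    refine (ig t).mono (hcosh.mul (cgt t)).aestronglyMeasurable (Filter.Eventually.of_forall fun x => ?_)
    rw [norm_mul]
    apply mul_le_of_le_one_left (norm_nonneg _)
    rw [Real.norm_of_nonneg (hcosh1 x), div_le_one (Real.cosh_pos x)]
    exact Real.one_le_cosh x
  apply fatou_step (fun N t => ∫ x in (-(N:ℝ))..(N:ℝ), (1 / Real.cosh x) * g t x)
  · intro N
    apply intervalIntegral.continuous_parametric_intervalIntegral_of_continuous'
    exact (hcosh.comp continuous_snd).mul cg
  · intro N t
    apply intervalIntegral.integral_nonneg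
    · have : (0:ℝ) ≤ N := by positivity
      linarith
    · intro x _
      exact mul_nonneg (hcosh1 x) (gpos t x)
  · intro t
    exact intervalIntegral_tendsto_integral (iw t)
      (Filter.tendsto_neg_atTop_atBot.comp tendsto_natCast_atTop_atTop) tendsto_natCast_atTop_atTop
  · intro N hN
    have hN1 : (1:ℝ) ≤ N := by exact_mod_cast hN
    have hN0 : (0:ℝ) < N := by linarith
    have hst := spacetime r C₀ κ (2*(N:ℝ)) N (2*(N:ℝ))⁻¹ ε hr hC hκ hκ0 (by linarith) hN0.le rfl hε.le hε1
      hsmall f hf A B hA hB (fun q => (eqc q.1 q.2).1) (fun q => (eqc q.1 q.2).2) a0 b0 hEX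
    have hle : ∫ t in (0:ℝ)..N, (∫ x in (-(N:ℝ))..(N:ℝ), (1 / Real.cosh x) * g t x) ≤
        ∫ t in (0:ℝ)..N, 64 * ∫ x in (0:ℝ)..(2*(N:ℝ)), (1 - x * (2*(N:ℝ))⁻¹)^4 * exp (-x/2)^2 * g t x := by
      apply intervalIntegral.integral_mono_on hN0.le
      · apply Continuous.intervalIntegrable
        apply intervalIntegral.continuous_parametric_intervalIntegral_of_continuous'
        exact (hcosh.comp continuous_snd).mul cg
      · apply Continuous.intervalIntegrable
        apply Continuous.mul continuous_const
        apply intervalIntegral.continuous_parametric_intervalIntegral_of_continuous'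
        simp only [hg]
        fun_prop
      · intro t _
        exact half_line_bound (g t) (cgt t) (gpos t) (geven t) N hN0
    rw [intervalIntegral.integral_const_mul] at hle
    have e : (N:ℝ) * ((105 + 24 * C₀ + 4 * κ) * (2*(N:ℝ))⁻¹ * ε^2) = (105 + 24 * C₀ + 4 * κ) / 2 * ε^2 := by
      field_simp
    rw [e] at hst
    have hK : 0 ≤ (105 + 24 * C₀ + 4 * κ) * ε^2 := by positivity
    simp only [hg] at hle ⊢
    linarith
end
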